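/- Let T₁, T₂ be a pair of minimal actions of G on ℝ-trees whose core is non-empty, and let Ĉ be the augmented core. Then there is an equivariant deformation retraction of T₁ × T₂ onto Ĉ; in particular Ĉ is contractible. Moreover, for any rectangle R = I₁ × I₂ ⊂ T₁ × T₂, the set R ∩ Ĉ is empty or contractible. -/

import Mathlib

/-!
Formalization of definitions from V. Guirardel,
"Core and intersection number for group actions on trees".
-/

open Set Metric Filter Function Topology
open scoped ENNReal Pointwise

noncomputable section

namespace Guirardel

/-- The metric segment `[x,y]`: the set of points lying metrically between `x` and `y`.
In an `ℝ`-tree this is the image of the geodesic from `x` to `y`. -/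
def seg {T : Type*} [MetricSpace T] (x y : T) : Set T :=
  {p : T | dist x p + dist p y = dist x y}

/-- The open segment `]x,y[`. -/
def openSeg {T : Type*} [MetricSpace T] (x y : T) : Set T :=
  seg x y \ {x, y}

/-- A subset of an `ℝ`-tree is convex (i.e. a subtree when nonempty) if it contains the
segment between any two of its points. -/
def TreeConvex {T : Type*} [MetricSpace T] (S : Set T) : Prop :=
  ∀ x ∈ S, ∀ y ∈ S, seg x y ⊆ S

/-- An `ℝ`-tree: any two points are joined by a geodesic, and any two injective paths
with the same endpoints have the same image (uniqueness of arcs). -/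
structure IsRTree (T : Type*) [MetricSpace T] : Prop where
  exists_geod : ∀ x y : T, ∃ f : ℝ → T, f 0 = x ∧ f (dist x y) = y ∧
    ∀ s ∈ Icc (0 : ℝ) (dist x y), ∀ t ∈ Icc (0 : ℝ) (dist x y),
      dist (f s) (f t) = |s - t|
  arc_unique : ∀ (x y : T) (γ₁ γ₂ : Path x y),
    Function.Injective γ₁ → Function.Injective γ₂ →
      Set.range γ₁ = Set.range γ₂

/-- A direction based at `x`: a connected component of the complement of `x`. -/
def IsDirectionAt {T : Type*} [MetricSpace T] (δ : Set T) (x : T) : Prop :=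
  ∃ y : T, y ≠ x ∧ δ = connectedComponentIn {x}ᶜ y

/-- A direction in a tree. -/
def IsDirection {T : Type*} [MetricSpace T] (δ : Set T) : Prop :=
  ∃ x : T, IsDirectionAt δ x

/-- A branch point: a point with at least three directions. -/
def IsBranchPoint {T : Type*} [MetricSpace T] (x : T) : Prop :=
  ∃ δ₁ δ₂ δ₃ : Set T, IsDirectionAt δ₁ x ∧ IsDirectionAt δ₂ x ∧ IsDirectionAt δ₃ x ∧
    δ₁ ≠ δ₂ ∧ δ₁ ≠ δ₃ ∧ δ₂ ≠ δ₃

/-- A quadrant in `T₁ × T₂`: a product of two directions. -/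
def IsQuadrant {T₁ T₂ : Type*} [MetricSpace T₁] [MetricSpace T₂]
    (Q : Set (T₁ × T₂)) : Prop :=
  ∃ (δ₁ : Set T₁) (δ₂ : Set T₂), IsDirection δ₁ ∧ IsDirection δ₂ ∧ Q = δ₁ ×ˢ δ₂

/-- A quadrant is heavy if (for every choice of base point, which does not matter) there
is a sequence of orbit points inside it whose two coordinates go to infinity. -/
def Heavy (G : Type*) {T₁ T₂ : Type*} [Group G] [MetricSpace T₁] [MetricSpace T₂]
    [MulAction G T₁] [MulAction G T₂] (Q : Set (T₁ × T₂)) : Prop :=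
  ∀ p : T₁ × T₂, ∃ γ : ℕ → G,
    (∀ k, ((γ k • p.1 : T₁), (γ k • p.2 : T₂)) ∈ Q) ∧
    Tendsto (fun k => dist (γ k • p.1) p.1) atTop atTop ∧
    Tendsto (fun k => dist (γ k • p.2) p.2) atTop atTop

/-- The core of `T₁ × T₂`: the complement of the union of all light (i.e. non-heavy)
quadrants; equivalently the set of points all of whose quadrants are heavy. -/
def Core (G T₁ T₂ : Type*) [Group G] [MetricSpace T₁] [MetricSpace T₂]
    [MulAction G T₁] [MulAction G T₂] : Set (T₁ × T₂) :=
  {z : T₁ × T₂ | ∀ Q : Set (T₁ × T₂), IsQuadrant Q → z ∈ Q → Heavy G Q}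

/-- A subset of `T₁ × T₂` has convex fibers if its horizontal and vertical fibers
are convex. -/
def ConvexFibers {T₁ T₂ : Type*} [MetricSpace T₁] [MetricSpace T₂]
    (E : Set (T₁ × T₂)) : Prop :=
  (∀ x₁ : T₁, TreeConvex {y₂ : T₂ | (x₁, y₂) ∈ E}) ∧
  (∀ x₂ : T₂, TreeConvex {y₁ : T₁ | (y₁, x₂) ∈ E})

/-- The action of `G` on `T` is by isometries. -/
def IsometricAction (G T : Type*) [MetricSpace T] [SMul G T] : Prop :=
  ∀ (g : G) (x y : T), dist (g • x) (g • y) = dist x y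

/-- `g` is elliptic: it fixes a point of `T`. -/
def Elliptic {G : Type*} (T : Type*) [SMul G T] (g : G) : Prop :=
  ∃ x : T, g • x = x

/-- `g` is hyperbolic: it fixes no point of `T`. -/
def Hyperbolic {G : Type*} (T : Type*) [SMul G T] (g : G) : Prop :=
  ∀ x : T, g • x ≠ x

/-- Translation length of `g` on `T`. -/
def translationLength {G : Type*} (T : Type*) [MetricSpace T] [SMul G T] (g : G) : ℝ :=
  ⨅ x : T, dist x (g • x)

/-- The axis (characteristic set) of `g`: points minimizing displacement. -/
def axisSet {G : Type*} (T : Type*) [MetricSpace T] [SMul G T] (g : G) : Set T :=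
  {x : T | ∀ y : T, dist x (g • x) ≤ dist y (g • y)}

/-- The action is non-trivial: some element is hyperbolic. -/
def NontrivialAction (G T : Type*) [SMul G T] : Prop :=
  ∃ g : G, ∀ x : T, g • x ≠ x

/-- The action is free: only the identity fixes a point. -/
def FreeAction (G T : Type*) [Group G] [MulAction G T] : Prop :=
  ∀ g : G, g ≠ 1 → ∀ x : T, g • x ≠ x

/-- The action is minimal: no proper nonempty invariant subtree. -/
def MinimalAction (G T : Type*) [MetricSpace T] [SMul G T] : Prop :=
  ∀ S : Set T, S.Nonempty → TreeConvex S → (∀ g : G, ∀ x ∈ S, g • x ∈ S) → S = univ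

/-- The minimal subtree for the subset `H` of `G`: the intersection of all nonempty
invariant subtrees. -/
def minSubtreeOf {G : Type*} (H : Set G) (T : Type*) [MetricSpace T] [SMul G T] : Set T :=
  ⋂₀ {S : Set T | S.Nonempty ∧ TreeConvex S ∧ ∀ g ∈ H, ∀ x ∈ S, g • x ∈ S}

/-- The minimal subtree of the `G`-action. -/
def minSubtree (G T : Type*) [MetricSpace T] [SMul G T] : Set T :=
  minSubtreeOf (univ : Set G) T

/-- A line in `T`: the image of an isometric embedding of `ℝ`. -/
def IsLine {T : Type*} [MetricSpace T] (L : Set T) : Prop :=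
  ∃ f : ℝ → T, (∀ s t : ℝ, dist (f s) (f t) = |s - t|) ∧ L = range f

/-- A ray in `T`: the image of an isometric embedding of `[0,∞)`. -/
def IsRay {T : Type*} [MetricSpace T] (R : Set T) : Prop :=
  ∃ f : ℝ → T, (∀ s ∈ Ici (0 : ℝ), ∀ t ∈ Ici (0 : ℝ), dist (f s) (f t) = |s - t|) ∧
    R = f '' Ici 0

/-- Two rays (or subsets) define the same end when they are at finite Hausdorff distance. -/
def SameEnd {T : Type*} [MetricSpace T] (R R' : Set T) : Prop :=
  EMetric.hausdorffEdist R R' ≠ ⊤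

/-- The action of `G` fixes an end of `T`. -/
def GFixedEnd (G T : Type*) [MetricSpace T] [SMul G T] : Prop :=
  ∃ R : Set T, IsRay R ∧ ∀ g : G, SameEnd ((fun x => g • x) '' R) R

/-- The action of `G` has an invariant line. -/
def GInvariantLine (G T : Type*) [MetricSpace T] [SMul G T] : Prop :=
  ∃ L : Set T, IsLine L ∧ ∀ g : G, (fun x => g • x) '' L = L

/-- The action is irreducible: no invariant line and no fixed end. -/
def IrreducibleAction (G T : Type*) [MetricSpace T] [SMul G T] : Prop :=
  ¬ GInvariantLine G T ∧ ¬ GFixedEnd G T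

/-- The action is dihedral: there is an invariant line on which some element acts as a
reflection (i.e. with non-constant displacement along the line). -/
def DihedralAction (G T : Type*) [MetricSpace T] [SMul G T] : Prop :=
  ∃ L : Set T, IsLine L ∧ (∀ g : G, (fun x => g • x) '' L = L) ∧
    ∃ g : G, ∃ x ∈ L, ∃ y ∈ L, dist x (g • x) ≠ dist y (g • y)

/-- `A` is a positive semi-axis of `g`: a ray contained in the axis of `g` and mapped
into itself by `g`. -/
def PosSemiAxis {G : Type*} (T : Type*) [MetricSpace T] [SMul G T] (g : G) (A : Set T) :
    Prop :=
  IsRay A ∧ A ⊆ axisSet T g ∧ (fun x => g • x) '' A ⊆ A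

/-- `g` translates towards the end determined by the ray `R`:
`g` is hyperbolic and has a positive semi-axis defining the same end as `R`. -/
def TranslatesToward {G : Type*} (T : Type*) [MetricSpace T] [SMul G T] (g : G)
    (R : Set T) : Prop :=
  Hyperbolic T g ∧ ∃ A : Set T, PosSemiAxis T g A ∧ SameEnd A R

/-- The end `ω_T(g)` of the hyperbolic element `g` lies in the set of ends of `δ`:
some positive semi-axis of `g` is contained in `δ`. -/
def EndInSubtree {G : Type*} (T : Type*) [MetricSpace T] [SMul G T] (g : G)
    (δ : Set T) : Prop :=
  ∃ A : Set T, PosSemiAxis T g A ∧ A ⊆ δ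

/-- A map between `ℝ`-trees preserves alignment if the image of a point between `y`
and `z` lies between the images of `y` and `z`. -/
def AlignPreserving {T T' : Type*} [MetricSpace T] [MetricSpace T'] (f : T → T') : Prop :=
  ∀ x y z : T, x ∈ seg y z → f x ∈ seg (f y) (f z)

/-- `f : T → T'` witnesses that `T` is a refinement of `T'`: it is an equivariant
continuous surjection preserving alignment. -/
def IsRefinementMap (G : Type*) {T T' : Type*} [Group G] [MetricSpace T] [MetricSpace T']
    [MulAction G T] [MulAction G T'] (f : T → T') : Prop :=
  Continuous f ∧ Surjective f ∧ AlignPreserving f ∧ ∀ (g : G) (x : T), f (g • x) = g • f x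

/-- The length functions of the two actions are homothetic. -/
def HomotheticLengths (G T₁ T₂ : Type*) [MetricSpace T₁] [MetricSpace T₂] [SMul G T₁]
    [SMul G T₂] : Prop :=
  ∃ c : ℝ, 0 < c ∧ ∀ g : G, translationLength T₁ g = c * translationLength T₂ g

/-- A bundled `ℝ`-tree with an isometric action of `G`. -/
structure GTree (G : Type*) [Group G] where
  carrier : Type
  [ms : MetricSpace carrier]
  [ma : MulAction G carrier]
  isom : ∀ (g : G) (x y : carrier), dist (g • x) (g • y) = dist x y
  tree : IsRTree carrier

attribute [instance] GTree.ms GTree.ma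

/-- A simplicial structure on an `ℝ`-tree: a vertex set containing all branch points,
meeting every segment in a finite set, and discrete. -/
def IsSimplicialStructure {T : Type*} [MetricSpace T] (V : Set T) : Prop :=
  (∀ x : T, IsBranchPoint x → x ∈ V) ∧
  (∀ x y : T, (seg x y ∩ V).Finite) ∧
  (∀ v ∈ V, ∃ ε > 0, ∀ w ∈ V, dist v w < ε → w = v)

/-- Two vertices of a simplicial tree are adjacent (span an edge). -/
def Adjacent {T : Type*} [MetricSpace T] (V : Set T) (v w : T) : Prop :=
  v ∈ V ∧ w ∈ V ∧ v ≠ w ∧ seg v w ∩ V = {v, w}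

/-- A bundled simplicial `G`-tree. -/
structure SimplicialGTree (G : Type*) [Group G] extends GTree G where
  V : Set carrier
  simp : IsSimplicialStructure V
  inv : ∀ g : G, (fun x => g • x) '' V = V

/-- `T₁` and `T₂` are refinements of a common non-trivial simplicial action of `G`. -/
def RefineCommonSimplicial (G T₁ T₂ : Type*) [Group G] [MetricSpace T₁] [MetricSpace T₂]
    [MulAction G T₁] [MulAction G T₂] : Prop :=
  ∃ T' : SimplicialGTree G, NontrivialAction G T'.carrier ∧
    (∃ f₁ : T₁ → T'.carrier, IsRefinementMap G f₁) ∧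
    (∃ f₂ : T₂ → T'.carrier, IsRefinementMap G f₂)

/-- Two directions face each other: their union is the whole tree. -/
def FacingDirections {T : Type*} [MetricSpace T] (δ δ' : Set T) : Prop :=
  δ ∪ δ' = univ

/-- There is a twice-light rectangle with (opposite) base corners `x` and `x'`:
two light quadrants based at `x` and `x'` facing each other. -/
def IsTwiceLightRect (G : Type*) {T₁ T₂ : Type*} [Group G] [MetricSpace T₁]
    [MetricSpace T₂] [MulAction G T₁] [MulAction G T₂] (x x' : T₁ × T₂) : Prop :=
  ∃ (δ₁ : Set T₁) (δ₂ : Set T₂) (δ₁' : Set T₁) (δ₂' : Set T₂),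
    IsDirectionAt δ₁ x.1 ∧ IsDirectionAt δ₂ x.2 ∧
    IsDirectionAt δ₁' x'.1 ∧ IsDirectionAt δ₂' x'.2 ∧
    x.1 ≠ x'.1 ∧ x.2 ≠ x'.2 ∧
    FacingDirections δ₁ δ₁' ∧ FacingDirections δ₂ δ₂' ∧
    ¬ Heavy G (δ₁ ×ˢ δ₂) ∧ ¬ Heavy G (δ₁' ×ˢ δ₂')

/-- The open rectangle with opposite corners `x, x'`. -/
def openRect {T₁ T₂ : Type*} [MetricSpace T₁] [MetricSpace T₂] (x x' : T₁ × T₂) :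
    Set (T₁ × T₂) :=
  openSeg x.1 x'.1 ×ˢ openSeg x.2 x'.2

/-- A maximal twice-light rectangle. -/
def IsMaxTwiceLightRect (G : Type*) {T₁ T₂ : Type*} [Group G] [MetricSpace T₁]
    [MetricSpace T₂] [MulAction G T₁] [MulAction G T₂] (x x' : T₁ × T₂) : Prop :=
  IsTwiceLightRect G x x' ∧ ∀ y y' : T₁ × T₂, IsTwiceLightRect G y y' →
    openRect x x' ⊆ openRect y y' → openRect x x' = openRect y y'

/-- The straight diagonal of a rectangle joining the two opposite corners `p` and `q`. -/
def mainDiag {T₁ T₂ : Type*} [MetricSpace T₁] [MetricSpace T₂] (p q : T₁ × T₂) :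
    Set (T₁ × T₂) :=
  {z : T₁ × T₂ | z.1 ∈ seg p.1 q.1 ∧ z.2 ∈ seg p.2 q.2 ∧
    dist p.1 z.1 * dist p.2 q.2 = dist p.2 z.2 * dist p.1 q.1}

/-- The augmented core: the union of the core and of the main diagonals of the maximal
twice-light rectangles (the diagonals joining the two opposite corners lying in the core). -/
def AugCore (G T₁ T₂ : Type*) [Group G] [MetricSpace T₁] [MetricSpace T₂]
    [MulAction G T₁] [MulAction G T₂] : Set (T₁ × T₂) :=
  Core G T₁ T₂ ∪
    {z : T₁ × T₂ | ∃ x x' p q : T₁ × T₂, IsMaxTwiceLightRect G x x' ∧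
      p ∈ Core G T₁ T₂ ∧ q ∈ Core G T₁ T₂ ∧
      ({p.1, q.1} : Set T₁) = {x.1, x'.1} ∧ ({p.2, q.2} : Set T₂) = {x.2, x'.2} ∧
      p.1 ≠ q.1 ∧ p.2 ≠ q.2 ∧ z ∈ mainDiag p q}

/-- There exists an equivariant (strong) deformation retraction of `T₁ × T₂` onto `C`. -/
def EquivDeformRetract (G : Type*) {T₁ T₂ : Type*} [Group G] [MetricSpace T₁]
    [MetricSpace T₂] [MulAction G T₁] [MulAction G T₂] (C : Set (T₁ × T₂)) : Prop :=
  ∃ H : ℝ → T₁ × T₂ → T₁ × T₂,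
    Continuous (fun p : ℝ × (T₁ × T₂) => H p.1 p.2) ∧
    (∀ z : T₁ × T₂, H 0 z = z) ∧
    (∀ z : T₁ × T₂, H 1 z ∈ C) ∧
    (∀ t : ℝ, ∀ z ∈ C, H t z = z) ∧
    (∀ (t : ℝ) (g : G) (z : T₁ × T₂), H t (g • z) = g • H t z)

/-- The `ℓ²` product distance on `T₁ × T₂`. -/
def dist2 {T₁ T₂ : Type*} [MetricSpace T₁] [MetricSpace T₂] (p q : T₁ × T₂) : ℝ :=
  Real.sqrt (dist p.1 q.1 ^ 2 + dist p.2 q.2 ^ 2)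

/-- The length of a path `c : [0,1] → T₁ × T₂`, measured with the `ℓ²` product metric. -/
def pathLen2 {T₁ T₂ : Type*} [MetricSpace T₁] [MetricSpace T₂] (c : ℝ → T₁ × T₂) :
    ℝ≥0∞ :=
  ⨆ (n : ℕ) (u : Fin (n + 1) → ℝ) (_ : Monotone u) (_ : ∀ i, u i ∈ Icc (0 : ℝ) 1),
    ∑ i : Fin n, ENNReal.ofReal (dist2 (c (u i.castSucc)) (c (u i.succ)))

/-- The path metric induced on a subset `C ⊆ T₁ × T₂` by the `ℓ²` product metric. -/
def pathDistOn {T₁ T₂ : Type*} [MetricSpace T₁] [MetricSpace T₂] (C : Set (T₁ × T₂))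
    (x y : C) : ℝ :=
  (⨅ (c : ℝ → T₁ × T₂) (_ : ContinuousOn c (Icc (0 : ℝ) 1))
      (_ : MapsTo c (Icc (0 : ℝ) 1) C) (_ : c 0 = (x : T₁ × T₂))
      (_ : c 1 = (y : T₁ × T₂)), pathLen2 c).toReal

/-- A distance function makes a set a CAT(0) space: it is a metric, geodesic, and the
CN-inequality of Bruhat–Tits holds (comparison triangles are at least as thick). -/
structure IsCAT0Dist {X : Type*} (d : X → X → ℝ) : Prop where
  refl : ∀ x, d x x = 0
  symm : ∀ x y, d x y = d y x
  triangle : ∀ x y z, d x z ≤ d x y + d y z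
  eq_of_dist_eq_zero : ∀ x y, d x y = 0 → x = y
  geodesic : ∀ x y, ∃ f : ℝ → X, f 0 = x ∧ f (d x y) = y ∧
    ∀ s ∈ Icc (0 : ℝ) (d x y), ∀ t ∈ Icc (0 : ℝ) (d x y), d (f s) (f t) = |s - t|
  cn : ∀ x y z m, d y m = d y z / 2 → d m z = d y z / 2 →
    d x m ^ 2 ≤ (d x y ^ 2 + d x z ^ 2) / 2 - d y z ^ 2 / 4

/-- A 2-cell of the core of a product of two simplicial trees: a rectangle which is a
product of two edges and is contained in the core. -/
def IsCoreCell (G : Type*) {T₁ T₂ : Type*} [Group G] [MetricSpace T₁] [MetricSpace T₂]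
    [MulAction G T₁] [MulAction G T₂] (V₁ : Set T₁) (V₂ : Set T₂)
    (R : Set (T₁ × T₂)) : Prop :=
  ∃ v₁ w₁ v₂ w₂, Adjacent V₁ v₁ w₁ ∧ Adjacent V₂ v₂ w₂ ∧
    R = seg v₁ w₁ ×ˢ seg v₂ w₂ ∧ R ⊆ Core G T₁ T₂


/-- A geodesic metric space satisfying the four point condition. -/
structure FourPointTree (T : Type*) [MetricSpace T] : Prop where
  four_point : ∀ x y z w : T,
    dist x y + dist z w ≤ max (dist x z + dist y w) (dist x w + dist y z)
  exists_point : ∀ (x y : T) (s : ℝ), 0 ≤ s → s ≤ dist x y →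
    ∃ p, dist x p = s ∧ dist p y = dist x y - s

section Arcs

variable {T : Type*} [MetricSpace T]

/-- `f` restricted to `[0,L]` is a unit speed geodesic. -/
def IsGeodOn (f : ℝ → T) (L : ℝ) : Prop :=
  ∀ s ∈ Icc (0 : ℝ) L, ∀ t ∈ Icc (0 : ℝ) L, dist (f s) (f t) = |s - t|

theorem exists_injective_path {φ : ℝ → T} {L : ℝ} (hL : 0 < L)
    (hc : ContinuousOn φ (Icc 0 L)) (hi : InjOn φ (Icc 0 L)) :
    ∃ γ : Path (φ 0) (φ L), Injective γ ∧ range γ = φ '' Icc 0 L := by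
  have hmem : ∀ t : unitInterval, (t : ℝ) * L ∈ Icc (0 : ℝ) L := fun t =>
    ⟨mul_nonneg t.2.1 hL.le, by nlinarith [t.2.2]⟩
  refine ⟨⟨⟨fun t => φ (t * L), ?_⟩, by simp, by simp⟩, ?_, ?_⟩
  · exact hc.comp_continuous (by fun_prop) hmem
  · intro s t hst
    have := hi (hmem s) (hmem t) hst
    exact Subtype.ext (mul_right_cancel₀ hL.ne' this)
  · ext p
    constructor
    · rintro ⟨t, rfl⟩
      exact ⟨t * L, hmem t, rfl⟩
    · rintro ⟨s, hs, rfl⟩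
      refine ⟨⟨s / L, div_nonneg hs.1 hL.le, (div_le_one hL).2 hs.2⟩, ?_⟩
      change φ (s / L * L) = φ s
      rw [div_mul_cancel₀ _ hL.ne']

theorem IsRTree.image_eq (hT : IsRTree T) {φ ψ : ℝ → T} {L M : ℝ} (hL : 0 < L) (hM : 0 < M)
    (hφ : ContinuousOn φ (Icc 0 L)) (hφi : InjOn φ (Icc 0 L))
    (hψ : ContinuousOn ψ (Icc 0 M)) (hψi : InjOn ψ (Icc 0 M))
    (h0 : φ 0 = ψ 0) (h1 : φ L = ψ M) : φ '' Icc 0 L = ψ '' Icc 0 M := by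
  obtain ⟨γ, hγ, hγr⟩ := exists_injective_path hL hφ hφi
  obtain ⟨η, hη, hηr⟩ := exists_injective_path hM hψ hψi
  rw [← hγr, ← hηr]
  have := hT.arc_unique _ _ γ (η.cast h0 h1) hγ (by simpa using hη)
  simpa using this

theorem continuousOn_of_dist_le {f : ℝ → T} {S : Set ℝ}
    (hf : ∀ s ∈ S, ∀ t ∈ S, dist (f s) (f t) ≤ |s - t|) : ContinuousOn f S :=
  (LipschitzOnWith.of_dist_le_mul (K := 1) fun s hs t ht => by
    simpa [Real.dist_eq] using hf s hs t ht).continuousOn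

theorem IsGeodOn.continuousOn {f : ℝ → T} {L : ℝ} (hf : IsGeodOn f L) :
    ContinuousOn f (Icc 0 L) :=
  continuousOn_of_dist_le fun s hs t ht => (hf s hs t ht).le

theorem IsGeodOn.injOn {f : ℝ → T} {L : ℝ} (hf : IsGeodOn f L) : InjOn f (Icc 0 L) := by
  intro s hs t ht hst
  have := hf s hs t ht
  rw [hst, dist_self] at this
  linarith [abs_eq_zero.1 this.symm]

theorem IsGeodOn.mono {f : ℝ → T} {L M : ℝ} (hf : IsGeodOn f L) (h : M ≤ L) : IsGeodOn f M :=
  fun s hs t ht => hf s ⟨hs.1, hs.2.trans h⟩ t ⟨ht.1, ht.2.trans h⟩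

theorem IsRTree.geod_unique (hT : IsRTree T) {f g : ℝ → T} {L : ℝ} (hf : IsGeodOn f L)
    (hg : IsGeodOn g L) (h0 : f 0 = g 0) (h1 : f L = g L) {s : ℝ} (hs : s ∈ Icc 0 L) :
    f s = g s := by
  rcases (hs.1.trans hs.2).eq_or_lt with hL | hL
  · obtain rfl : s = 0 := le_antisymm (hL ▸ hs.2) hs.1
    exact h0
  · have h := hT.image_eq hL hL hf.continuousOn hf.injOn hg.continuousOn hg.injOn h0 h1
    obtain ⟨t, ht, hts⟩ : f s ∈ g '' Icc 0 L := h ▸ mem_image_of_mem f hs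
    have e1 := hf 0 ⟨le_rfl, hL.le⟩ s hs
    have e2 := hg 0 ⟨le_rfl, hL.le⟩ t ht
    rw [hts, ← h0, e1, zero_sub, zero_sub, abs_neg, abs_neg, abs_of_nonneg hs.1,
      abs_of_nonneg ht.1] at e2
    rw [← hts, e2]

theorem IsRTree.exists_tripod (hT : IsRTree T) {f g : ℝ → T} {L M : ℝ} (hL : 0 ≤ L) (hM : 0 ≤ M)
    (hf : IsGeodOn f L) (hg : IsGeodOn g M) (h0 : f 0 = g 0) :
    ∃ t, 0 ≤ t ∧ t ≤ L ∧ t ≤ M ∧ f t = g t ∧ dist (f L) (g M) = L - t + (M - t) := by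
  have hsame : ∀ s ∈ Icc 0 L, ∀ t ∈ Icc 0 M, f s = g t → s = t := by
    intro s hs t ht h
    have e1 := hf 0 ⟨le_rfl, hL⟩ s hs
    have e2 := hg 0 ⟨le_rfl, hM⟩ t ht
    rw [← h, ← h0, e1, zero_sub, zero_sub, abs_neg, abs_neg, abs_of_nonneg hs.1,
      abs_of_nonneg ht.1] at e2
    exact e2
  have hK : IsCompact {t ∈ Icc 0 (min L M) | f t = g t} := by
    have hcl : IsClosed {t ∈ Icc 0 (min L M) | (f t, g t) ∈ diagonal T} :=
      ((hf.continuousOn.mono (Icc_subset_Icc_right (min_le_left _ _))).prodMk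
        (hg.continuousOn.mono (Icc_subset_Icc_right (min_le_right _ _)))).preimage_isClosed_of_isClosed
          isClosed_Icc isClosed_diagonal
    exact isCompact_Icc.of_isClosed_subset hcl fun t ht => ht.1
  obtain ⟨t, ⟨⟨ht0, htm⟩, hfg⟩, hmax⟩ :=
    hK.exists_isMaxOn ⟨0, ⟨le_rfl, le_min hL hM⟩, h0⟩ continuousOn_id
  have htL := htm.trans (min_le_left _ _)
  have htM := htm.trans (min_le_right _ _)
  refine ⟨t, ht0, htL, htM, hfg, ?_⟩
  rcases (add_nonneg (sub_nonneg.2 htL) (sub_nonneg.2 htM)).eq_or_lt with hz | hpos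
  · have e1 : L = t := by linarith
    have e2 : M = t := by linarith
    rw [e1, e2, hfg, dist_self]; ring
  set ψ : ℝ → T := fun s => if s ≤ L - t then f (L - s) else g (s - L + 2 * t) with hψ
  set N := L - t + (M - t) with hN
  have hlip : ∀ s ∈ Icc 0 N, ∀ u ∈ Icc 0 N, s ≤ u → dist (ψ s) (ψ u) ≤ u - s := by
    intro s hs u hu hsu
    by_cases h1 : u ≤ L - t
    · have h2 : s ≤ L - t := hsu.trans h1
      simp only [hψ, h1, h2, if_true]
      rw [hf _ ⟨by linarith, by linarith [hs.1]⟩ _ ⟨by linarith, by linarith [hu.1]⟩]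
      rw [abs_of_nonneg (by linarith)]; linarith
    · by_cases h2 : s ≤ L - t
      · simp only [hψ, h1, h2, if_true, if_false]
        push Not at h1
        have e1 := hf (L - s) ⟨by linarith, by linarith [hs.1]⟩ t ⟨ht0, htL⟩
        have e2 := hg t ⟨ht0, htM⟩ (u - L + 2 * t) ⟨by linarith, by linarith [hu.2]⟩
        rw [abs_of_nonneg (by linarith)] at e1
        rw [abs_of_nonpos (by linarith)] at e2
        have := dist_triangle (f (L - s)) (f t) (g (u - L + 2 * t))
        rw [e1, hfg, e2] at this
        linarith
      · simp only [hψ, h1, h2, if_false]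
        push Not at h1 h2
        rw [hg _ ⟨by linarith, by linarith [hs.2]⟩ _ ⟨by linarith, by linarith [hu.2]⟩]
        rw [abs_of_nonpos (by linarith)]; linarith
  have hcont : ContinuousOn ψ (Icc 0 N) := continuousOn_of_dist_le fun s hs u hu => by
    rcases le_total s u with h | h
    · rw [abs_of_nonpos (by linarith)]; linarith [hlip s hs u hu h]
    · rw [abs_of_nonneg (by linarith), dist_comm]; linarith [hlip u hu s hs h]
  have hne : ∀ s ∈ Icc 0 N, ∀ u ∈ Icc 0 N, s < u → ψ s ≠ ψ u := by
    intro s hs u hu hsu heq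
    by_cases h1 : u ≤ L - t
    · have h2 : s ≤ L - t := hsu.le.trans h1
      simp only [hψ, h1, h2, if_true] at heq
      have := hf.injOn ⟨by linarith, by linarith [hs.1]⟩ ⟨by linarith, by linarith [hu.1]⟩ heq
      linarith
    · by_cases h2 : s ≤ L - t
      · simp only [hψ, h1, h2, if_true, if_false] at heq
        push Not at h1
        have h3 := hsame _ ⟨by linarith, by linarith [hs.1]⟩ _
          ⟨by linarith, by linarith [hu.2]⟩ heq
        rw [← h3] at heq
        have h4 : L - s ≤ t := hmax (show L - s ∈ {t ∈ Icc 0 (min L M) | f t = g t} from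
          ⟨⟨by linarith, le_min (by linarith [hs.1]) (by linarith [hu.2])⟩, heq⟩)
        linarith
      · simp only [hψ, h1, h2, if_false] at heq
        push Not at h1 h2
        have := hg.injOn ⟨by linarith, by linarith [hs.2]⟩ ⟨by linarith, by linarith [hu.2]⟩ heq
        linarith
  have hinj : InjOn ψ (Icc 0 N) := by
    intro s hs u hu heq
    rcases lt_trichotomy s u with h | h | h
    · exact absurd heq (hne s hs u hu h)
    · exact h
    · exact absurd heq.symm (hne u hu s hs h)
  have hψ0 : ψ 0 = f L := by simp [hψ, htL]
  have hψN : ψ N = g M := by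
    by_cases h : N ≤ L - t
    · have : M = t := by linarith
      simp only [hψ, h, if_true, this]
      rw [← hfg]; congr 1; linarith
    · simp only [hψ, h, if_false]; congr 1; linarith
  have hψm : ψ (L - t) = f t := by simp [hψ]
  obtain ⟨φ, hφ0, hφ1, hφ⟩ := hT.exists_geod (f L) (g M)
  have hφ : IsGeodOn φ (dist (f L) (g M)) := hφ
  have hdpos : 0 < dist (f L) (g M) := by
    refine dist_pos.2 ?_
    rw [← hψ0, ← hψN]
    exact hne 0 ⟨le_rfl, hpos.le⟩ N ⟨hpos.le, le_rfl⟩ hpos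
  have him := hT.image_eq hpos hdpos hcont hinj hφ.continuousOn hφ.injOn
    (hψ0.trans hφ0.symm) (hψN.trans hφ1.symm)
  obtain ⟨r, hr, hrt⟩ : f t ∈ φ '' Icc 0 (dist (f L) (g M)) :=
    him ▸ ⟨L - t, ⟨by linarith, by linarith⟩, hψm⟩
  have e1 := hφ 0 ⟨le_rfl, hdpos.le⟩ r hr
  have e2 := hφ r hr _ ⟨hdpos.le, le_rfl⟩
  rw [hφ0, hrt, hf L ⟨hL, le_rfl⟩ t ⟨ht0, htL⟩, abs_of_nonneg (by linarith),
    abs_of_nonpos (by linarith [hr.1])] at e1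
  rw [hφ1, hrt, hfg, hg t ⟨ht0, htM⟩ M ⟨hM, le_rfl⟩, abs_of_nonpos (by linarith),
    abs_of_nonpos (by linarith [hr.2])] at e2
  linarith

theorem IsRTree.fourPointTree (hT : IsRTree T) : FourPointTree T where
  four_point x y z w := by
    choose f hf0 hf1 hf using fun v => hT.exists_geod x v
    have hf : ∀ v, IsGeodOn (f v) (dist x v) := hf
    have trip : ∀ u v, ∃ t, 0 ≤ t ∧ t ≤ dist x u ∧ t ≤ dist x v ∧ f u t = f v t ∧
        dist u v = dist x u - t + (dist x v - t) := fun u v => by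
      simpa only [hf1] using hT.exists_tripod (f := f u) (g := f v) dist_nonneg dist_nonneg
        (hf u) (hf v) ((hf0 u).trans (hf0 v).symm)
    have agree : ∀ u v t s, t ≤ dist x u → t ≤ dist x v → f u t = f v t → s ∈ Icc 0 t →
        f u s = f v s := fun u v t s hu hv h hs =>
      hT.geod_unique ((hf u).mono hu) ((hf v).mono hv) ((hf0 u).trans (hf0 v).symm) h hs
    have upper : ∀ u v t, 0 ≤ t → t ≤ dist x u → t ≤ dist x v → f u t = f v t →
        dist u v ≤ dist x u - t + (dist x v - t) := by
      intro u v t ht hu hv h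
      have e1 := hf u t ⟨ht, hu⟩ _ ⟨dist_nonneg, le_rfl⟩
      have e2 := hf v t ⟨ht, hv⟩ _ ⟨dist_nonneg, le_rfl⟩
      rw [hf1, abs_of_nonpos (by linarith)] at e1 e2
      have := dist_triangle_left u v (f u t)
      rw [e1, h, e2] at this
      linarith
    obtain ⟨t, ht0, htz, hty, ht, hd⟩ := trip z y
    obtain ⟨s, hs0, hsy, hsw, hs, hd'⟩ := trip y w
    rw [dist_comm y z]
    rcases le_total t s with h | h
    · have h1 := agree y w s t hsy hsw hs ⟨ht0, h⟩
      have := upper z w t ht0 htz (h.trans hsw) (ht.trans h1)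
      exact le_max_of_le_right (by linarith)
    · have h1 := agree z y t s htz hty ht ⟨hs0, h⟩
      have := upper z w s hs0 (h.trans htz) hsw (h1.trans hs)
      exact le_max_of_le_left (by linarith)
  exists_point x y s hs hsd := by
    obtain ⟨f, hf0, hf1, hf⟩ := hT.exists_geod x y
    refine ⟨f s, ?_, ?_⟩
    · have := hf 0 ⟨le_rfl, dist_nonneg⟩ s ⟨hs, hsd⟩
      rwa [hf0, zero_sub, abs_neg, abs_of_nonneg hs] at this
    · have := hf s ⟨hs, hsd⟩ _ ⟨dist_nonneg, le_rfl⟩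
      rw [hf1, abs_of_nonpos (by linarith)] at this
      linarith

end Arcs

section Segments

variable {T : Type*} [MetricSpace T] {x y z p q a b m v w : T}

theorem mem_seg_iff : p ∈ seg x y ↔ dist x p + dist p y = dist x y := Iff.rfl

theorem left_mem_seg (x y : T) : x ∈ seg x y := by simp [mem_seg_iff]

theorem right_mem_seg (x y : T) : y ∈ seg x y := by simp [mem_seg_iff]

theorem mem_seg_comm (h : p ∈ seg x y) : p ∈ seg y x := by
  rw [mem_seg_iff] at *
  rw [dist_comm y p, dist_comm p x, dist_comm y x, add_comm, h]

theorem seg_comm (x y : T) : seg x y = seg y x :=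
  Set.ext fun _ => ⟨mem_seg_comm, mem_seg_comm⟩

theorem dist_left_le (h : p ∈ seg x y) : dist x p ≤ dist x y := by
  rw [mem_seg_iff] at h
  linarith [dist_nonneg (x := p) (y := y)]

theorem eq_of_mem_seg_self (h : p ∈ seg x x) : p = x := by
  rw [mem_seg_iff, dist_self, dist_comm p x] at h
  exact (dist_eq_zero.1 (by linarith [dist_nonneg (x := x) (y := p)])).symm

theorem mem_seg_left_trans (hm : m ∈ seg x y) (hp : p ∈ seg x m) : p ∈ seg x y := by
  rw [mem_seg_iff] at *
  linarith [dist_triangle p m y, dist_triangle x p y]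

theorem mem_seg_right_trans (hm : m ∈ seg x y) (hp : p ∈ seg m y) : p ∈ seg x y :=
  mem_seg_comm (mem_seg_left_trans (mem_seg_comm hm) (mem_seg_comm hp))

theorem isClosed_seg (x y : T) : IsClosed (seg x y) :=
  isClosed_eq (by fun_prop) (by fun_prop)

/-- The point at distance `s` from `x` on the way to `a`. -/
def toward (x a : T) (s : ℝ) : T :=
  open scoped Classical in
  if h : ∃ p, dist x p = s ∧ dist p a = dist x a - s then h.choose else x

namespace FourPointTree

variable (hT : FourPointTree T)
include hT

theorem dist_toward {s : ℝ} (hs : 0 ≤ s) (hsa : s ≤ dist x a) :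
    dist x (toward x a s) = s ∧ dist (toward x a s) a = dist x a - s := by
  have h := hT.exists_point x a s hs hsa
  rw [toward, dif_pos h]
  exact h.choose_spec

theorem toward_mem_seg {s : ℝ} (hs : 0 ≤ s) (hsa : s ≤ dist x a) : toward x a s ∈ seg x a := by
  obtain ⟨h1, h2⟩ := hT.dist_toward hs hsa
  rw [mem_seg_iff, h1, h2]
  ring

theorem dist_eq_abs (hp : p ∈ seg x y) (hq : q ∈ seg x y) :
    dist p q = |dist x p - dist x q| := by
  rw [mem_seg_iff] at hp hq
  apply le_antisymm
  · have h := hT.four_point p q x y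
    rw [dist_comm p x, dist_comm q x] at h
    rcases le_max_iff.1 h with h | h
    · linarith [le_abs_self (dist x p - dist x q)]
    · linarith [neg_abs_le (dist x p - dist x q)]
  · rw [abs_le]
    constructor <;> linarith [dist_triangle x p q, dist_triangle_right x p q, dist_comm p q,
      dist_triangle x q p]

theorem eq_of_dist_eq (hp : p ∈ seg x y) (hq : q ∈ seg x y) (h : dist x p = dist x q) :
    p = q := by
  rw [← dist_eq_zero, hT.dist_eq_abs hp hq, h, sub_self, abs_zero]

theorem eq_toward {s : ℝ} (hp : p ∈ seg x y) (h : dist x p = s) : p = toward x y s := by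
  have h0 : 0 ≤ s := h ▸ dist_nonneg
  have h1 : s ≤ dist x y := h ▸ dist_left_le hp
  exact hT.eq_of_dist_eq hp (hT.toward_mem_seg h0 h1) (h.trans (hT.dist_toward h0 h1).1.symm)

theorem map_toward {f : T → T} (hf : Isometry f) {s : ℝ} (h0 : 0 ≤ s) (h1 : s ≤ dist x a) :
    f (toward x a s) = toward (f x) (f a) s := by
  obtain ⟨d1, d2⟩ := hT.dist_toward h0 h1
  refine hT.eq_toward ?_ (by rw [hf.dist_eq, d1])
  rw [mem_seg_iff, hf.dist_eq, hf.dist_eq, hf.dist_eq, d1, d2]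
  ring

theorem mem_seg_of_dist_le (hp : p ∈ seg x y) (hq : q ∈ seg x y) (h : dist x p ≤ dist x q) :
    p ∈ seg x q := by
  rw [mem_seg_iff, hT.dist_eq_abs hp hq, abs_of_nonpos (by linarith)]
  ring

theorem mem_seg_or (hp : p ∈ seg x y) (hq : q ∈ seg x y) : p ∈ seg x q ∨ p ∈ seg q y := by
  rcases le_total (dist x p) (dist x q) with h | h
  · exact Or.inl (hT.mem_seg_of_dist_le hp hq h)
  · refine Or.inr (mem_seg_comm (hT.mem_seg_of_dist_le (mem_seg_comm hp) (mem_seg_comm hq) ?_))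
    rw [mem_seg_iff] at hp hq
    rw [dist_comm y p, dist_comm y q]
    linarith

theorem exists_median (x y z : T) : ∃ m, m ∈ seg x y ∧ m ∈ seg y z ∧ m ∈ seg x z := by
  obtain ⟨m, h1, h2⟩ := hT.exists_point x y ((dist x y + dist x z - dist y z) / 2)
    (by linarith [dist_triangle y x z, dist_comm x y])
    (by linarith [dist_triangle x y z])
  have h3 : dist m z ≤ (dist x z + dist y z - dist x y) / 2 := by
    have h := hT.four_point m z x y
    rw [dist_comm m x, dist_comm z y, dist_comm z x] at h
    rcases le_max_iff.1 h with h | h <;> linarith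
  refine ⟨m, ?_, ?_, ?_⟩ <;> rw [mem_seg_iff]
  · linarith
  · linarith [dist_triangle y m z, dist_comm m y]
  · linarith [dist_triangle x m z]

theorem seg_subset (ha : a ∈ seg x y) (hb : b ∈ seg x y) : seg a b ⊆ seg x y := by
  intro p hp
  have key : ∀ {a b : T}, a ∈ seg x y → b ∈ seg x y → p ∈ seg a b → dist x a ≤ dist x b →
      p ∈ seg x y := by
    intro a b ha hb hp h
    have := hT.dist_eq_abs ha hb
    rw [abs_of_nonpos (by linarith)] at this
    rw [mem_seg_iff] at *
    linarith [dist_triangle x a p, dist_triangle p b y, dist_triangle x p y]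
  rcases le_total (dist x a) (dist x b) with h | h
  · exact key ha hb hp h
  · exact key hb ha (mem_seg_comm hp) h

theorem mem_seg_of_mem_seg (hm : m ∈ seg a b) (ha : w ∈ seg v a) (hb : w ∈ seg v b) :
    w ∈ seg v m := by
  rw [mem_seg_iff] at *
  have h := hT.four_point w m a b
  rw [dist_comm m b, dist_comm m a] at h
  rcases le_max_iff.1 h with h | h <;>
    linarith [dist_triangle v w m, dist_triangle v m b, dist_triangle v m a, dist_comm m a,
      dist_comm m b]

theorem image_toward_Icc (x y : T) : toward x y '' Icc 0 (dist x y) = seg x y := by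
  ext p
  constructor
  · rintro ⟨s, hs, rfl⟩
    exact hT.toward_mem_seg hs.1 hs.2
  · intro hp
    exact ⟨dist x p, ⟨dist_nonneg, dist_left_le hp⟩, (hT.eq_toward hp rfl).symm⟩

theorem continuousOn_toward (x y : T) : ContinuousOn (toward x y) (Icc 0 (dist x y)) := by
  refine continuousOn_of_dist_le fun s hs t ht => ?_
  rw [hT.dist_eq_abs (hT.toward_mem_seg hs.1 hs.2) (hT.toward_mem_seg ht.1 ht.2),
    (hT.dist_toward hs.1 hs.2).1, (hT.dist_toward ht.1 ht.2).1]

theorem isCompact_seg (x y : T) : IsCompact (seg x y) :=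
  hT.image_toward_Icc x y ▸ isCompact_Icc.image_of_continuousOn (hT.continuousOn_toward x y)

theorem isPreconnected_seg (x y : T) : IsPreconnected (seg x y) :=
  hT.image_toward_Icc x y ▸ isPreconnected_Icc.image _ (hT.continuousOn_toward x y)

theorem dist_le_of_toward_same {x' q' : T} (hq : q ∈ seg x a) (hq' : q' ∈ seg x' a)
    (h : dist x q = dist x' q') : dist q q' ≤ dist x x' := by
  rw [mem_seg_iff] at *
  have h1 := hT.four_point q q' x a
  have h2 := hT.four_point q' x x' a
  rw [dist_comm q x, dist_comm q' x] at h1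
  rw [dist_comm q' x', dist_comm q' x] at h2
  have h3 := dist_triangle x x' a
  have h4 := dist_triangle_left x' a x
  rcases le_max_iff.1 h1 with h1 | h1
  · linarith
  · rcases le_max_iff.1 h2 with h2 | h2 <;>
      linarith [dist_nonneg (x := x) (y := q), dist_comm x x']

end FourPointTree

end Segments

section Retraction

variable {T₁ T₂ : Type*} [MetricSpace T₁] [MetricSpace T₂]

/-- Any two points of `D` are joined by points of `D` over every intermediate value of either
coordinate, with the other coordinate remaining between those of the two points. -/
structure CrossConvex (D : Set (T₁ × T₂)) : Prop where
  left : ∀ p ∈ D, ∀ q ∈ D, ∀ x ∈ seg p.1 q.1, ∃ y ∈ seg p.2 q.2, (x, y) ∈ D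
  right : ∀ p ∈ D, ∀ q ∈ D, ∀ y ∈ seg p.2 q.2, ∃ x ∈ seg p.1 q.1, (x, y) ∈ D

theorem CrossConvex.swap {D : Set (T₁ × T₂)} (hD : CrossConvex D) :
    CrossConvex (Prod.swap ⁻¹' D) where
  left _ hp _ hq := hD.right _ hp _ hq
  right _ hp _ hq := hD.left _ hp _ hq

variable {D : Set (T₁ × T₂)}

theorem CrossConvex.dist_le_of_eq (hD : CrossConvex D) (h₁ : FourPointTree T₁)
    {x x' a a' q q' : T₁} {y y' : T₂} {s : ℝ} (ha : (a, y) ∈ D) (ha' : (a', y') ∈ D)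
    (hs : ∀ p ∈ D, s ≤ max (dist x p.1) (dist y p.2))
    (hq : q ∈ seg x a) (hq' : q' ∈ seg x' a') (hqs : dist x q = s) (hqs' : dist x' q' = s) :
    dist q q' ≤ 3 * max (dist x x') (dist y y') := by
  set ε := max (dist x x') (dist y y')
  have hε : dist x x' ≤ ε := le_max_left _ _
  have hε' : dist y y' ≤ ε := le_max_right _ _
  rcases le_or_gt s ε with h | h
  · linarith [dist_triangle4 q x x' q', dist_comm x q]
  obtain ⟨w, hxa, hw, hxa'⟩ := h₁.exists_median x a a'
  have hsw : s ≤ dist x w := by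
    obtain ⟨u, hu, hwu⟩ := hD.left _ ha _ ha' w hw
    rcases le_max_iff.1 (hs _ hwu) with h' | h'
    · exact h'
    · have := dist_left_le hu
      simp only at this h'
      linarith
  have hqa' : q ∈ seg x a' :=
    mem_seg_left_trans hxa' (h₁.mem_seg_of_dist_le hq hxa (hqs.trans_le hsw))
  have := h₁.dist_le_of_toward_same hqa' hq' (hqs.trans hqs'.symm)
  linarith [dist_nonneg (x := x) (y := x')]

theorem CrossConvex.dist_toward_le (hD : CrossConvex D) (h₁ : FourPointTree T₁)
    {x x' a a' : T₁} {y y' : T₂} {s s' : ℝ} (ha : (a, y) ∈ D) (ha' : (a', y') ∈ D)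
    (hs0 : 0 ≤ s) (hs0' : 0 ≤ s')
    (hs : ∀ p ∈ D, s ≤ max (dist x p.1) (dist y p.2))
    (hs' : ∀ p ∈ D, s' ≤ max (dist x' p.1) (dist y' p.2)) :
    dist (toward x a s) (toward x' a' s') ≤ 3 * max (dist x x') (dist y y') + |s - s'| := by
  have hsa : s ≤ dist x a := by simpa [hs0] using hs _ ha
  have hsa' : s' ≤ dist x' a' := by simpa using hs' _ ha'
  set r := min s s'
  have hr0 : 0 ≤ r := le_min hs0 hs0'
  have hr : r ≤ s := min_le_left _ _
  have hr' : r ≤ s' := min_le_right _ _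
  have m1 := h₁.toward_mem_seg hs0 hsa
  have m1' := h₁.toward_mem_seg hs0' hsa'
  have m2 := h₁.toward_mem_seg hr0 (hr.trans hsa)
  have m2' := h₁.toward_mem_seg hr0 (hr'.trans hsa')
  have d1 := (h₁.dist_toward hs0 hsa).1
  have d1' := (h₁.dist_toward hs0' hsa').1
  have d2 := (h₁.dist_toward hr0 (hr.trans hsa)).1
  have d2' := (h₁.dist_toward hr0 (hr'.trans hsa')).1
  have e1 := h₁.dist_eq_abs m1 m2
  have e2 := h₁.dist_eq_abs m2' m1'
  rw [d1, d2, abs_of_nonneg (by linarith)] at e1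
  rw [d1', d2', abs_of_nonpos (by linarith)] at e2
  have e3 := hD.dist_le_of_eq h₁ ha ha' (fun p hp => hr.trans (hs p hp)) m2 m2' d2 d2'
  have e4 := dist_triangle4 (toward x a s) (toward x a r) (toward x' a' r) (toward x' a' s')
  have e5 : s - r + (s' - r) = |s - s'| := by
    rcases le_total s s' with h | h
    · rw [abs_of_nonpos (by linarith)]; simp only [r, min_eq_left h]; ring
    · rw [abs_of_nonneg (by linarith)]; simp only [r, min_eq_right h]; ring
  linarith

theorem CrossConvex.corner_mem (hD : CrossConvex D) (hDc : IsClosed D)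
    (h₁ : FourPointTree T₁) (h₂ : FourPointTree T₂) {x g : T₁} {y b h h' : T₂} {τ : ℝ}
    (hb : (x, b) ∈ D) (hgh : (g, h) ∈ D) (hh : h ∈ seg y b)
    (hgτ : dist x g = τ) (hhτ : dist y h ≤ τ) (hh' : h' ∈ seg y b) (hhτ' : dist y h' = τ)
    (hτ : ∀ p ∈ D, τ ≤ max (dist x p.1) (dist y p.2)) : (g, h') ∈ D := by
  have hyh : h ∈ seg y h' := h₂.mem_seg_of_dist_le hh hh' (hhτ.trans hhτ'.ge)
  have hhb : h' ∈ seg h b := by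
    rcases h₂.mem_seg_or hh' hh with H | H
    · have := dist_left_le H
      rw [h₂.eq_of_dist_eq hh hh' (by linarith)]
      exact left_mem_seg _ _
    · exact H
  obtain ⟨g', hg', hgh'⟩ := hD.right _ hgh _ hb h' hhb
  rcases eq_or_ne g g' with rfl | hne
  · exact hgh'
  have hpos := dist_pos.2 hne
  rw [← hDc.closure_eq, Metric.mem_closure_iff]
  intro ε hε
  set s := min (ε / 2) (dist g g')
  have hs0 : 0 < s := lt_min (half_pos hε) hpos
  have hsε : s < ε := (min_le_left _ _).trans_lt (half_lt_self hε)
  have hsg : s ≤ dist g g' := min_le_right _ _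
  obtain ⟨d1, d2⟩ := h₁.dist_toward hs0.le hsg
  have hk := h₁.toward_mem_seg hs0.le hsg
  set k := toward g g' s
  obtain ⟨u, hu, hku⟩ := hD.left _ hgh _ hgh' k hk
  have hkx : k ∈ seg g x := mem_seg_left_trans hg' hk
  have hyu : τ ≤ dist y u := by
    rcases le_max_iff.1 (hτ _ hku) with H | H
    · rw [mem_seg_iff] at hkx
      simp only at H
      linarith [dist_comm k x, dist_comm g x]
    · exact H
  have hu' : u = h' := by
    rw [← dist_eq_zero]
    rw [mem_seg_iff] at hu hyh
    simp only at hu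
    linarith [dist_triangle y h u, dist_nonneg (x := u) (y := h')]
  rw [hu'] at hku
  refine ⟨_, hku, ?_⟩
  simp [Prod.dist_eq, d1, hsε, hε]

theorem CrossConvex.toward_mem (hD : CrossConvex D) (hDc : IsClosed D)
    (h₁ : FourPointTree T₁) (h₂ : FourPointTree T₂) {x a : T₁} {y b : T₂}
    (ha : (a, y) ∈ D) (hb : (x, b) ∈ D) :
    (toward x a (infDist (x, y) D), toward y b (infDist (x, y) D)) ∈ D := by
  set τ := infDist (x, y) D
  have hτ : ∀ p ∈ D, τ ≤ max (dist x p.1) (dist y p.2) := fun p hp => infDist_le_dist_of_mem hp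
  have hτ0 : 0 ≤ τ := infDist_nonneg
  have hτa : τ ≤ dist x a := by simpa using hτ _ ha
  have hτb : τ ≤ dist y b := by simpa using hτ _ hb
  have hK : IsCompact (D ∩ seg x a ×ˢ seg y b) :=
    ((h₁.isCompact_seg x a).prod (h₂.isCompact_seg y b)).inter_left hDc
  obtain ⟨⟨g, h⟩, ⟨hgh, hg, hh⟩, hmin⟩ := hK.exists_infDist_eq_dist
    ⟨(a, y), ha, right_mem_seg _ _, left_mem_seg _ _⟩ (x, y)
  simp only at hg hh
  have hle : max (dist x g) (dist y h) ≤ τ := by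
    change dist (x, y) (g, h) ≤ τ
    refine (le_infDist ⟨_, ha⟩).2 fun p hp => ?_
    obtain ⟨u, hux, hu, hup⟩ := h₁.exists_median x a p.1
    obtain ⟨v, hv, huv⟩ := hD.left _ ha _ hp u hu
    obtain ⟨k, hky, hk, hkv⟩ := h₂.exists_median y b v
    obtain ⟨w, hw, hwk⟩ := hD.right _ hb _ huv k hk
    have hwa : w ∈ seg x a := mem_seg_left_trans hux hw
    rw [← hmin]
    refine (infDist_le_dist_of_mem (show (w, k) ∈ D ∩ seg x a ×ˢ seg y b from
      ⟨hwk, hwa, hky⟩)).trans ?_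
    exact max_le_max ((dist_left_le hw).trans (dist_left_le hup))
      ((dist_left_le hkv).trans (dist_left_le hv))
  obtain ⟨hgle, hhle⟩ := max_le_iff.1 hle
  have d1 := (h₁.dist_toward hτ0 hτa).1
  have d2 := (h₂.dist_toward hτ0 hτb).1
  have m1 := h₁.toward_mem_seg hτ0 hτa
  have m2 := h₂.toward_mem_seg hτ0 hτb
  rcases le_max_iff.1 (hτ _ hgh) with H | H
  · have hgτ : dist x g = τ := le_antisymm hgle H
    rw [← h₁.eq_toward hg hgτ]
    exact hD.corner_mem hDc h₁ h₂ hb hgh hh hgτ hhle m2 d2 hτ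
  · have hhτ : dist y h = τ := le_antisymm hhle H
    rw [← h₂.eq_toward hh hhτ]
    exact hD.swap.corner_mem (hDc.preimage continuous_swap) h₂ h₁ (x := y) (y := x)
      (g := h) (h := g) ha hgh hg hhτ hgle m1 d1 fun p hp => by
        rw [max_comm]; exact hτ _ hp

theorem toward_zero (x a : T₁) : toward x a 0 = x := by
  unfold toward
  split_ifs with h
  · exact (dist_eq_zero.1 h.choose_spec.1).symm
  · rfl

theorem CrossConvex.exists_retraction (hD : CrossConvex D) (hDc : IsClosed D)
    (h₁ : FourPointTree T₁) (h₂ : FourPointTree T₂)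
    (hs₁ : ∀ x, ∃ y, (x, y) ∈ D) (hs₂ : ∀ y, ∃ x, (x, y) ∈ D) :
    ∃ H : ℝ → T₁ × T₂ → T₁ × T₂,
      Continuous (fun p : ℝ × (T₁ × T₂) => H p.1 p.2) ∧
      (∀ z, H 0 z = z) ∧ (∀ z, H 1 z ∈ D) ∧ (∀ t, ∀ z ∈ D, H t z = z) ∧
      ∀ (t : ℝ) (g₁ : T₁ → T₁) (g₂ : T₂ → T₂), Isometry g₁ → Isometry g₂ →
        Prod.map g₁ g₂ '' D = D → ∀ z, H t (Prod.map g₁ g₂ z) = Prod.map g₁ g₂ (H t z) := by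
  choose B hB using hs₁
  choose A hA using hs₂
  set σ : ℝ → T₁ × T₂ → ℝ := fun t z => max 0 (min t 1) * infDist z D with hσ
  have hσ0 : ∀ t z, 0 ≤ σ t z := fun t z => mul_nonneg (le_max_left _ _) infDist_nonneg
  have hσD : ∀ t z, ∀ p ∈ D, σ t z ≤ max (dist z.1 p.1) (dist z.2 p.2) := fun t z p hp =>
    (mul_le_of_le_one_left infDist_nonneg (max_le zero_le_one (min_le_right _ _))).trans
      (infDist_le_dist_of_mem hp)
  have hσc : Continuous fun p : ℝ × (T₁ × T₂) => σ p.1 p.2 := by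
    have := (continuous_infDist_pt D).comp (continuous_snd (X := ℝ) (Y := T₁ × T₂))
    exact (by fun_prop : Continuous fun p : ℝ × (T₁ × T₂) => max 0 (min p.1 1)).mul this
  have hσs : ∀ t z, ∀ p ∈ Prod.swap ⁻¹' D, σ t z ≤ max (dist z.2 p.1) (dist z.1 p.2) :=
    fun t z p hp => by rw [max_comm]; exact hσD t z _ hp
  set H : ℝ → T₁ × T₂ → T₁ × T₂ := fun t z =>
    (toward z.1 (A z.2) (σ t z), toward z.2 (B z.1) (σ t z)) with hH
  have close₁ : ∀ t z t' z', dist (H t z).1 (H t' z').1 ≤ 3 * dist z z' + |σ t z - σ t' z'| :=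
    fun t z t' z' => hD.dist_toward_le h₁ (hA z.2) (hA z'.2) (hσ0 _ _) (hσ0 _ _)
      (hσD t z) (hσD t' z')
  have close₂ : ∀ t z t' z', dist (H t z).2 (H t' z').2 ≤ 3 * dist z z' + |σ t z - σ t' z'| :=
    fun t z t' z' => by
      have := hD.swap.dist_toward_le h₂ (x := z.2) (x' := z'.2) (y := z.1) (y' := z'.1)
        (hB z.1) (hB z'.1) (hσ0 t z) (hσ0 t' z') (hσs t z) (hσs t' z')
      rwa [max_comm] at this
  have close : ∀ t z t' z', dist (H t z) (H t' z') ≤ 3 * dist z z' + |σ t z - σ t' z'| :=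
    fun t z t' z' => max_le (close₁ t z t' z') (close₂ t z t' z')
  refine ⟨H, ?_, ?_, ?_, ?_, ?_⟩
  · rw [continuous_iff_continuousAt]
    intro p
    rw [ContinuousAt, tendsto_iff_dist_tendsto_zero]
    refine squeeze_zero (fun _ => dist_nonneg) (fun q => close q.1 q.2 p.1 p.2) ?_
    have hc : Continuous fun q : ℝ × (T₁ × T₂) =>
        3 * dist q.2 p.2 + |σ q.1 q.2 - σ p.1 p.2| := by fun_prop
    simpa using hc.tendsto p
  · intro z
    have : σ 0 z = 0 := by simp [hσ]
    simp only [hH, this, toward_zero]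
  · intro z
    have : σ 1 z = infDist z D := by simp [hσ]
    simp only [hH, this]
    exact hD.toward_mem hDc h₁ h₂ (hA z.2) (hB z.1)
  · intro t z hz
    have : σ t z = 0 := by simp [hσ, infDist_zero_of_mem hz]
    simp only [hH, this, toward_zero]
  · intro t g₁ g₂ hg₁ hg₂ hg z
    have hgi : Isometry (Prod.map g₁ g₂) := by
      refine Isometry.of_dist_eq fun p q => ?_
      simp only [Prod.dist_eq, Prod.map_fst, Prod.map_snd, hg₁.dist_eq, hg₂.dist_eq]
    have hgD : ∀ p ∈ D, Prod.map g₁ g₂ p ∈ D := fun p hp => hg ▸ mem_image_of_mem _ hp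
    have hσg : σ t (Prod.map g₁ g₂ z) = σ t z := by
      simp only [hσ]
      congr 1
      conv_lhs => rw [← hg]
      exact infDist_image hgi
    have hza : σ t z ≤ dist z.1 (A z.2) := by simpa using hσD t z _ (hA z.2)
    have hzb : σ t z ≤ dist z.2 (B z.1) := by simpa using hσD t z _ (hB z.1)
    simp only [hH]
    rw [hσg]
    refine Prod.ext ?_ ?_
    · simp only [Prod.map_fst, Prod.map_snd]
      rw [h₁.map_toward hg₁ (hσ0 t z) hza, ← dist_le_zero]
      refine (hD.dist_toward_le h₁ (hA _) (hgD _ (hA z.2)) (hσ0 t z) (hσ0 t z)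
        ?_ ?_).trans_eq (by simp)
      all_goals exact fun p hp => hσg ▸ hσD t (Prod.map g₁ g₂ z) p hp
    · simp only [Prod.map_fst, Prod.map_snd]
      rw [h₂.map_toward hg₂ (hσ0 t z) hzb, ← dist_le_zero]
      refine (hD.swap.dist_toward_le h₂ (x := g₂ z.2) (x' := g₂ z.2) (y := g₁ z.1)
        (y' := g₁ z.1) (hB (g₁ z.1)) (hgD (z.1, B z.1) (hB z.1)) (hσ0 t z) (hσ0 t z) ?_ ?_).trans_eq (by simp)
      all_goals exact fun p hp => hσg ▸ hσs t (Prod.map g₁ g₂ z) p hp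

end Retraction


section MedianSets

namespace FourPointTree

variable {T : Type*} [MetricSpace T] {x y p q a b m s t : T} (hT : FourPointTree T)
include hT

theorem mem_seg_of_le_of_le (ha : a ∈ seg p q) (hb : b ∈ seg p q) (hy : y ∈ seg p q)
    (h1 : dist p a ≤ dist p y) (h2 : dist p y ≤ dist p b) : y ∈ seg a b := by
  rw [mem_seg_iff, hT.dist_eq_abs ha hy, hT.dist_eq_abs hy hb, hT.dist_eq_abs ha hb,
    abs_of_nonpos (by linarith), abs_of_nonpos (by linarith), abs_of_nonpos (by linarith)]
  ring

theorem le_and_le_of_mem_seg (ha : a ∈ seg p q) (hb : b ∈ seg p q) (h : dist p a ≤ dist p b)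
    (hx : x ∈ seg a b) : dist p a ≤ dist p x ∧ dist p x ≤ dist p b := by
  have e := hT.dist_eq_abs ha hb
  rw [abs_of_nonpos (by linarith)] at e
  rw [mem_seg_iff] at hx
  constructor <;> linarith [dist_triangle p a x, dist_triangle p x b,
    dist_nonneg (x := a) (y := x), dist_nonneg (x := x) (y := b)]

theorem mem_seg_concat (hp : p ∈ seg s q) (hq : q ∈ seg p t) (h : p ≠ q) : p ∈ seg s t := by
  have hpos := dist_pos.2 h
  rw [mem_seg_iff] at *
  have := hT.four_point s q p t
  rw [dist_comm q p] at this
  rcases le_max_iff.1 this with h | h <;>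
    linarith [dist_triangle s p t]

theorem openSeg_nonempty (h : x ≠ y) : (openSeg x y).Nonempty := by
  have hpos := dist_pos.2 h
  have h0 : 0 ≤ dist x y / 2 := by linarith
  have h1 : dist x y / 2 ≤ dist x y := by linarith
  obtain ⟨d1, d2⟩ := hT.dist_toward h0 h1
  refine ⟨_, hT.toward_mem_seg h0 h1, ?_⟩
  rintro (e | e)
  · rw [e, dist_self] at d1; linarith
  · rw [mem_singleton_iff.1 e, dist_self] at d2; linarith

end FourPointTree

theorem openSeg_comm {T : Type*} [MetricSpace T] (x y : T) : openSeg x y = openSeg y x := by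
  rw [openSeg, openSeg, seg_comm, pair_comm]

theorem eq_or_eq_of_notMem_openSeg {T : Type*} [MetricSpace T] {x y p : T} (h : p ∉ openSeg x y)
    (hp : p ∈ seg x y) : p = x ∨ p = y := by
  by_contra hn
  exact h ⟨hp, hn⟩

variable {T₁ T₂ : Type*} [MetricSpace T₁] [MetricSpace T₂]

theorem mainDiag_comm (p q : T₁ × T₂) : mainDiag p q = mainDiag q p := by
  have key : ∀ p q : T₁ × T₂, mainDiag p q ⊆ mainDiag q p := by
    rintro p q z ⟨h1, h2, h3⟩
    refine ⟨mem_seg_comm h1, mem_seg_comm h2, ?_⟩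
    rw [mem_seg_iff] at h1 h2
    rw [dist_comm q.1 z.1, dist_comm q.2 z.2, dist_comm q.2 p.2, dist_comm q.1 p.1,
      ← h1, ← h2]
    rw [← h1, ← h2] at h3
    linarith
  exact (key p q).antisymm (key q p)

theorem left_mem_mainDiag (p q : T₁ × T₂) : p ∈ mainDiag p q :=
  ⟨left_mem_seg _ _, left_mem_seg _ _, by simp⟩

theorem right_mem_mainDiag (p q : T₁ × T₂) : q ∈ mainDiag p q :=
  mainDiag_comm q p ▸ left_mem_mainDiag q p

theorem isClosed_mainDiag (p q : T₁ × T₂) : IsClosed (mainDiag p q) :=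
  ((isClosed_seg p.1 q.1).preimage continuous_fst).inter
    (((isClosed_seg p.2 q.2).preimage continuous_snd).inter
      (isClosed_eq (by fun_prop) (by fun_prop)))

theorem mem_mainDiag_swap {p q z : T₁ × T₂} :
    z.swap ∈ mainDiag p.swap q.swap ↔ z ∈ mainDiag p q :=
  ⟨fun ⟨h1, h2, h3⟩ => ⟨h2, h1, h3.symm⟩, fun ⟨h1, h2, h3⟩ => ⟨h2, h1, h3.symm⟩⟩

theorem exists_mem_mainDiag (h₁ : FourPointTree T₁) (h₂ : FourPointTree T₂) {p q a b : T₁ × T₂}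
    (hpq : p.1 ≠ q.1) (ha : a ∈ mainDiag p q) (hb : b ∈ mainDiag p q) {x : T₁}
    (hx : x ∈ seg a.1 b.1) : ∃ y ∈ seg a.2 b.2, (x, y) ∈ mainDiag p q := by
  have key : ∀ {a b : T₁ × T₂}, a ∈ mainDiag p q → b ∈ mainDiag p q →
      dist p.1 a.1 ≤ dist p.1 b.1 → x ∈ seg a.1 b.1 →
      ∃ y ∈ seg a.2 b.2, (x, y) ∈ mainDiag p q := by
    intro a b ha hb hab hx
    obtain ⟨ha1, ha2, ha3⟩ := ha
    obtain ⟨hb1, hb2, hb3⟩ := hb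
    have hL := dist_pos.2 hpq
    obtain ⟨l1, l2⟩ := h₁.le_and_le_of_mem_seg ha1 hb1 hab hx
    have hxs := h₁.seg_subset ha1 hb1 hx
    have hxL := dist_left_le hxs
    set s := dist p.1 x * dist p.2 q.2 / dist p.1 q.1 with hs
    have hs0 : 0 ≤ s := by positivity
    have hs1 : s ≤ dist p.2 q.2 := by
      rw [hs, div_le_iff₀ hL, mul_comm (dist p.2 q.2)]
      exact mul_le_mul_of_nonneg_right hxL dist_nonneg
    obtain ⟨d1, d2⟩ := h₂.dist_toward hs0 hs1
    have hm := h₂.toward_mem_seg hs0 hs1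
    refine ⟨_, h₂.mem_seg_of_le_of_le ha2 hb2 hm ?_ ?_, hxs, hm, ?_⟩
    · rw [d1, hs, le_div_iff₀ hL, ← ha3]
      exact mul_le_mul_of_nonneg_right l1 dist_nonneg
    · rw [d1, hs, div_le_iff₀ hL, ← hb3]
      exact mul_le_mul_of_nonneg_right l2 dist_nonneg
    · change dist p.1 x * dist p.2 q.2 = dist p.2 (toward p.2 q.2 s) * dist p.1 q.1
      rw [d1, hs, div_mul_cancel₀ _ hL.ne']
  rcases le_total (dist p.1 a.1) (dist p.1 b.1) with h | h
  · exact key ha hb h hx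
  · obtain ⟨y, hy, hxy⟩ := key hb ha h (mem_seg_comm hx)
    exact ⟨y, mem_seg_comm hy, hxy⟩

/-- Closed subsets of a product of trees with convex fibers, stable under medians. -/
structure MedianSet (C : Set (T₁ × T₂)) : Prop where
  isClosed : IsClosed C
  median_mem : ∀ {p q r : T₁ × T₂} {m : T₁} {n : T₂}, p ∈ C → q ∈ C → r ∈ C →
    m ∈ seg p.1 q.1 → m ∈ seg q.1 r.1 → m ∈ seg p.1 r.1 →
    n ∈ seg p.2 q.2 → n ∈ seg q.2 r.2 → n ∈ seg p.2 r.2 → (m, n) ∈ C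
  convexFibers : ConvexFibers C

/-- Two points of `C` spanning a rectangle whose two open sides are missed by the projections
of `C`. -/
structure IsJump (C : Set (T₁ × T₂)) (p q : T₁ × T₂) : Prop where
  left_mem : p ∈ C
  right_mem : q ∈ C
  fst_ne : p.1 ≠ q.1
  snd_ne : p.2 ≠ q.2
  fst_notMem : ∀ c ∈ C, c.1 ∉ openSeg p.1 q.1
  snd_notMem : ∀ c ∈ C, c.2 ∉ openSeg p.2 q.2

/-- The union of `C` with the diagonals of all its jumps. -/
def jumpHull (C : Set (T₁ × T₂)) : Set (T₁ × T₂) :=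
  C ∪ {z | ∃ p q, IsJump C p q ∧ z ∈ mainDiag p q}

theorem MedianSet.swap {C : Set (T₁ × T₂)} (hC : MedianSet C) :
    MedianSet (Prod.swap ⁻¹' C) where
  isClosed := hC.isClosed.preimage continuous_swap
  median_mem hp hq hr h1 h2 h3 h4 h5 h6 := hC.median_mem hp hq hr h4 h5 h6 h1 h2 h3
  convexFibers := ⟨hC.convexFibers.2, hC.convexFibers.1⟩

variable {C : Set (T₁ × T₂)} {p q : T₁ × T₂}

theorem IsJump.symm (h : IsJump C p q) : IsJump C q p where
  left_mem := h.right_mem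
  right_mem := h.left_mem
  fst_ne := h.fst_ne.symm
  snd_ne := h.snd_ne.symm
  fst_notMem := by rw [openSeg_comm]; exact h.fst_notMem
  snd_notMem := by rw [openSeg_comm]; exact h.snd_notMem

theorem IsJump.swap (h : IsJump C p q) : IsJump (Prod.swap ⁻¹' C) p.swap q.swap where
  left_mem := h.left_mem
  right_mem := h.right_mem
  fst_ne := h.snd_ne
  snd_ne := h.fst_ne
  fst_notMem c hc := h.snd_notMem c.swap hc
  snd_notMem c hc := h.fst_notMem c.swap hc

theorem jumpHull_swap (C : Set (T₁ × T₂)) :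
    jumpHull (Prod.swap ⁻¹' C) = Prod.swap ⁻¹' jumpHull C := by
  ext z
  refine or_congr Iff.rfl ⟨?_, ?_⟩
  · rintro ⟨p, q, h, hz⟩
    exact ⟨p.swap, q.swap, h.swap, mem_mainDiag_swap.2 hz⟩
  · rintro ⟨p, q, h, hz⟩
    exact ⟨p.swap, q.swap, h.swap, mem_mainDiag_swap.2 hz⟩

theorem IsJump.corner_notMem (h : IsJump C p q) (hC : MedianSet C) (h₂ : FourPointTree T₂) :
    (p.1, q.2) ∉ C := by
  intro hm
  obtain ⟨y, hy⟩ := h₂.openSeg_nonempty h.snd_ne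
  exact h.snd_notMem _ (hC.convexFibers.1 p.1 p.2 h.left_mem q.2 hm hy.1) hy

/-- Every point of `C` is separated from a jump by one of the two end points of the jump. -/
theorem IsJump.exists_gate (h : IsJump C p q) (hC : MedianSet C) (h₁ : FourPointTree T₁)
    (h₂ : FourPointTree T₂) {b : T₁ × T₂} (hb : b ∈ C) :
    ∃ r, (r = p ∨ r = q) ∧ r.1 ∈ seg p.1 b.1 ∧ r.1 ∈ seg q.1 b.1 ∧
      r.2 ∈ seg p.2 b.2 ∧ r.2 ∈ seg q.2 b.2 := by
  obtain ⟨m, m1, m2, m3⟩ := h₁.exists_median p.1 q.1 b.1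
  obtain ⟨n, n1, n2, n3⟩ := h₂.exists_median p.2 q.2 b.2
  have hr := hC.median_mem h.left_mem h.right_mem hb m1 m2 m3 n1 n2 n3
  refine ⟨(m, n), ?_, m3, m2, n3, n2⟩
  rcases eq_or_eq_of_notMem_openSeg (h.fst_notMem _ hr) m1 with rfl | rfl <;>
    rcases eq_or_eq_of_notMem_openSeg (h.snd_notMem _ hr) n1 with rfl | rfl
  · exact Or.inl rfl
  · exact absurd hr (h.corner_notMem hC h₂)
  · exact absurd hr (h.symm.corner_notMem hC h₂)
  · exact Or.inr rfl

theorem IsJump.eq_of_concat {s t : T₁ × T₂} (h : IsJump C p q) (h' : IsJump C s t)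
    (h₁ : FourPointTree T₁) (h₂ : FourPointTree T₂) (a1 : p.1 ∈ seg s.1 q.1)
    (a2 : p.2 ∈ seg s.2 q.2) (b1 : q.1 ∈ seg p.1 t.1) (b2 : q.2 ∈ seg p.2 t.2) : p = s := by
  refine Prod.ext ?_ ?_
  · refine (eq_or_eq_of_notMem_openSeg (h'.fst_notMem _ h.left_mem)
      (h₁.mem_seg_concat a1 b1 h.fst_ne)).resolve_right fun e => h.fst_ne ?_
    rw [← e] at b1
    exact (eq_of_mem_seg_self b1).symm
  · refine (eq_or_eq_of_notMem_openSeg (h'.snd_notMem _ h.left_mem)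
      (h₂.mem_seg_concat a2 b2 h.snd_ne)).resolve_right fun e => h.snd_ne ?_
    rw [← e] at b2
    exact (eq_of_mem_seg_self b2).symm

theorem IsJump.mem_mainDiag_or (h : IsJump C p q) (hC : MedianSet C) (h₁ : FourPointTree T₁)
    (h₂ : FourPointTree T₂) {a b : T₁ × T₂} (ha : a ∈ mainDiag p q) (hb : b ∈ jumpHull C) :
    b ∈ mainDiag p q ∨ ∃ r, (r = p ∨ r = q) ∧ r.1 ∈ seg a.1 b.1 ∧ r.2 ∈ seg a.2 b.2 := by
  have fin : ∀ r, (r = p ∨ r = q) → r.1 ∈ seg p.1 b.1 → r.1 ∈ seg q.1 b.1 →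
      r.2 ∈ seg p.2 b.2 → r.2 ∈ seg q.2 b.2 →
      ∃ r, (r = p ∨ r = q) ∧ r.1 ∈ seg a.1 b.1 ∧ r.2 ∈ seg a.2 b.2 := fun r hr r1 r2 r3 r4 =>
    ⟨r, hr,
      mem_seg_comm (h₁.mem_seg_of_mem_seg ha.1 (mem_seg_comm r1) (mem_seg_comm r2)),
      mem_seg_comm (h₂.mem_seg_of_mem_seg ha.2.1 (mem_seg_comm r3) (mem_seg_comm r4))⟩
  rcases hb with hb | ⟨s, t, h', hb⟩
  · obtain ⟨r, hr, r1, r2, r3, r4⟩ := h.exists_gate hC h₁ h₂ hb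
    exact Or.inr (fin r hr r1 r2 r3 r4)
  obtain ⟨r, hr, r1, r2, r3, r4⟩ := h.exists_gate hC h₁ h₂ h'.left_mem
  obtain ⟨u, hu, u1, u2, u3, u4⟩ := h.exists_gate hC h₁ h₂ h'.right_mem
  by_cases hru : r = u
  · subst hru
    exact Or.inr (fin r hr (h₁.mem_seg_of_mem_seg hb.1 r1 u1) (h₁.mem_seg_of_mem_seg hb.1 r2 u2)
      (h₂.mem_seg_of_mem_seg hb.2.1 r3 u3) (h₂.mem_seg_of_mem_seg hb.2.1 r4 u4))
  left
  rcases hr with rfl | rfl <;> rcases hu with rfl | rfl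
  · exact absurd rfl hru
  · have e1 := h.eq_of_concat h' h₁ h₂ (mem_seg_comm r2) (mem_seg_comm r4) u1 u3
    have e2 := h.symm.eq_of_concat h'.symm h₁ h₂ (mem_seg_comm u1) (mem_seg_comm u3) r2 r4
    rw [e1, e2]
    exact hb
  · have e1 := h.eq_of_concat h'.symm h₁ h₂ (mem_seg_comm u2) (mem_seg_comm u4) r1 r3
    have e2 := h.symm.eq_of_concat h' h₁ h₂ (mem_seg_comm r1) (mem_seg_comm r3) u2 u4
    rw [e1, e2, mainDiag_comm]
    exact hb
  · exact absurd rfl hru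

theorem MedianSet.exists_mem_jumpHull (hC : MedianSet C) (h₁ : FourPointTree T₁)
    (h₂ : FourPointTree T₂) (hp : p ∈ C) (hq : q ∈ C) {x : T₁} (hx : x ∈ seg p.1 q.1) :
    ∃ y ∈ seg p.2 q.2, (x, y) ∈ jumpHull C := by
  by_cases hex : ∃ y, (x, y) ∈ C
  · obtain ⟨y, hy⟩ := hex
    obtain ⟨n, n1, n2, n3⟩ := h₂.exists_median p.2 q.2 y
    exact ⟨n, n1, Or.inl (hC.median_mem hp hq hy hx (right_mem_seg _ _) (right_mem_seg _ _)
      n1 n2 n3)⟩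
  have hK : ∀ u v : T₁, IsCompact (C ∩ seg u v ×ˢ seg p.2 q.2) := fun u v =>
    ((h₁.isCompact_seg u v).prod (h₂.isCompact_seg p.2 q.2)).inter_left hC.isClosed
  obtain ⟨⟨s, t⟩, ⟨⟨hs, hs1, hs2⟩, ht, ht1, ht2⟩, hmin⟩ :=
    ((hK p.1 x).prod (hK x q.1)).exists_isMinOn
      ⟨(p, q), ⟨hp, left_mem_seg _ _, left_mem_seg _ _⟩, hq, right_mem_seg _ _,
        right_mem_seg _ _⟩
      (f := fun u => dist u.1.1 u.2.1 + dist u.1.2 u.2.2) (by fun_prop)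
  simp only at hs hs1 hs2 ht ht1 ht2
  have hxs : x ∈ seg s.1 t.1 := by
    rw [mem_seg_iff] at *
    linarith [dist_triangle4 p.1 s.1 t.1 q.1, dist_triangle s.1 x t.1]
  have hsub := h₂.seg_subset hs2 ht2
  have eq_or : ∀ m ∈ C, m.1 ∈ seg s.1 t.1 → m.2 ∈ seg s.2 t.2 → m = s ∨ m = t := by
    intro m hm m1 m2
    rcases h₁.mem_seg_or m1 hxs with h | h
    · have := isMinOn_iff.1 hmin (m, t) ⟨⟨hm, mem_seg_right_trans hs1 h, hsub m2⟩, ht, ht1, ht2⟩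
      simp only at this
      rw [mem_seg_iff] at m1 m2
      left
      refine Prod.ext ?_ ?_ <;> refine (dist_le_zero.1 ?_).symm <;>
        linarith [dist_nonneg (x := s.1) (y := m.1), dist_nonneg (x := s.2) (y := m.2)]
    · have := isMinOn_iff.1 hmin (s, m) ⟨⟨hs, hs1, hs2⟩, hm, mem_seg_left_trans ht1 h, hsub m2⟩
      simp only at this
      rw [mem_seg_iff] at m1 m2
      right
      refine Prod.ext ?_ ?_ <;> refine dist_le_zero.1 ?_ <;>
        linarith [dist_nonneg (x := m.1) (y := t.1), dist_nonneg (x := m.2) (y := t.2)]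
  have hJ : IsJump C s t := by
    refine ⟨hs, ht, fun e => ?_, fun e => ?_, fun c hc hcs => ?_, fun c hc hcs => ?_⟩
    · rw [← e] at hxs
      rw [eq_of_mem_seg_self hxs] at hex
      exact hex ⟨_, hs⟩
    · refine hex ⟨s.2, hC.convexFibers.2 s.2 s.1 hs t.1 ?_ hxs⟩
      rw [mem_ofPred_eq, e]
      exact ht
    · obtain ⟨n, n1, n2, n3⟩ := h₂.exists_median s.2 t.2 c.2
      have hm := hC.median_mem hs ht hc hcs.1 (right_mem_seg _ _) (right_mem_seg _ _) n1 n2 n3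
      exact hcs.2 ((eq_or _ hm hcs.1 n1).elim
        (fun e => Or.inl (Prod.ext_iff.1 e).1)
        fun e => Or.inr (Prod.ext_iff.1 e).1)
    · obtain ⟨n, n1, n2, n3⟩ := h₁.exists_median s.1 t.1 c.1
      have hm := hC.median_mem hs ht hc n1 n2 n3 hcs.1 (right_mem_seg _ _) (right_mem_seg _ _)
      exact hcs.2 ((eq_or _ hm n1 hcs.1).elim
        (fun e => Or.inl (Prod.ext_iff.1 e).2)
        fun e => Or.inr (Prod.ext_iff.1 e).2)
  obtain ⟨y, hy, hxy⟩ := exists_mem_mainDiag h₁ h₂ hJ.fst_ne (left_mem_mainDiag s t)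
    (right_mem_mainDiag s t) hxs
  exact ⟨y, hsub hy, Or.inr ⟨s, t, hJ, hxy⟩⟩

theorem IsJump.mem_of_eq_or_eq (h : IsJump C p q) {r : T₁ × T₂} (hr : r = p ∨ r = q) :
    r ∈ C ∧ r ∈ mainDiag p q := by
  rcases hr with rfl | rfl
  exacts [⟨h.left_mem, left_mem_mainDiag _ _⟩, ⟨h.right_mem, right_mem_mainDiag _ _⟩]

theorem MedianSet.exists_of_mem_mainDiag (hC : MedianSet C) (h₁ : FourPointTree T₁)
    (h₂ : FourPointTree T₂) (h : IsJump C p q) {a b : T₁ × T₂} (ha : a ∈ mainDiag p q)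
    (hb : b ∈ jumpHull C)
    (hstep : ∀ r ∈ C, ∀ x ∈ seg r.1 b.1, ∃ y ∈ seg r.2 b.2, (x, y) ∈ jumpHull C) :
    ∀ x ∈ seg a.1 b.1, ∃ y ∈ seg a.2 b.2, (x, y) ∈ jumpHull C := by
  intro x hx
  rcases h.mem_mainDiag_or hC h₁ h₂ ha hb with hb' | ⟨r, hr, r1, r2⟩
  · obtain ⟨y, hy, hxy⟩ := exists_mem_mainDiag h₁ h₂ h.fst_ne ha hb' hx
    exact ⟨y, hy, Or.inr ⟨p, q, h, hxy⟩⟩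
  obtain ⟨hrC, hrD⟩ := h.mem_of_eq_or_eq hr
  rcases h₁.mem_seg_or hx r1 with hx | hx
  · obtain ⟨y, hy, hxy⟩ := exists_mem_mainDiag h₁ h₂ h.fst_ne ha hrD hx
    exact ⟨y, mem_seg_left_trans r2 hy, Or.inr ⟨p, q, h, hxy⟩⟩
  · obtain ⟨y, hy, hxy⟩ := hstep r hrC x hx
    exact ⟨y, mem_seg_right_trans r2 hy, hxy⟩

theorem MedianSet.exists_mem_of_mem_jumpHull (hC : MedianSet C) (h₁ : FourPointTree T₁)
    (h₂ : FourPointTree T₂) {a b : T₁ × T₂} (ha : a ∈ jumpHull C) (hb : b ∈ jumpHull C) :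
    ∀ x ∈ seg a.1 b.1, ∃ y ∈ seg a.2 b.2, (x, y) ∈ jumpHull C := by
  have half : ∀ a ∈ jumpHull C, ∀ b ∈ C, ∀ x ∈ seg a.1 b.1,
      ∃ y ∈ seg a.2 b.2, (x, y) ∈ jumpHull C := by
    rintro a (ha | ⟨p, q, h, ha⟩) b hb
    · exact fun x => hC.exists_mem_jumpHull h₁ h₂ ha hb
    · exact hC.exists_of_mem_mainDiag h₁ h₂ h ha (Or.inl hb)
        fun r hr x => hC.exists_mem_jumpHull h₁ h₂ hr hb
  have half' : ∀ r ∈ C, ∀ x ∈ seg r.1 b.1, ∃ y ∈ seg r.2 b.2, (x, y) ∈ jumpHull C := by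
    intro r hr x hx
    rw [seg_comm r.2]
    exact half b hb r hr x (mem_seg_comm hx)
  rcases ha with ha | ⟨p, q, h, ha⟩
  · exact half' a ha
  · exact hC.exists_of_mem_mainDiag h₁ h₂ h ha hb half'

theorem MedianSet.crossConvex_jumpHull (hC : MedianSet C) (h₁ : FourPointTree T₁)
    (h₂ : FourPointTree T₂) : CrossConvex (jumpHull C) where
  left p hp q hq := hC.exists_mem_of_mem_jumpHull h₁ h₂ hp hq
  right p hp q hq := by
    have := hC.swap.exists_mem_of_mem_jumpHull h₂ h₁ (a := p.swap) (b := q.swap)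
    rw [jumpHull_swap] at this
    exact this hp hq

theorem MedianSet.isClosed_jumpHull (hC : MedianSet C) (h₁ : FourPointTree T₁)
    (h₂ : FourPointTree T₂) : IsClosed (jumpHull C) := by
  refine isClosed_of_closure_subset fun z hz => ?_
  by_cases hzC : z ∈ C
  · exact Or.inl hzC
  obtain ⟨ρ, hρ, hball⟩ := Metric.isOpen_iff.1 hC.isClosed.isOpen_compl z hzC
  rw [Metric.mem_closure_iff] at hz
  obtain ⟨a, ha, hza⟩ := hz (ρ / 4) (by positivity)
  rcases ha with ha | ⟨p, q, h, ha⟩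
  · exact absurd ha (hball (by rw [mem_ball, dist_comm]; linarith))
  refine Or.inr ⟨p, q, h, ?_⟩
  rw [← (isClosed_mainDiag p q).closure_eq, Metric.mem_closure_iff]
  intro ε hε
  obtain ⟨b, hb, hzb⟩ := hz (min ε (ρ / 4)) (lt_min hε (by positivity))
  refine ⟨b, ?_, hzb.trans_le (min_le_left _ _)⟩
  refine (h.mem_mainDiag_or hC h₁ h₂ ha hb).resolve_right ?_
  rintro ⟨r, hr, r1, r2⟩
  refine hball ?_ (h.mem_of_eq_or_eq hr).1
  have hb' : dist z b < ρ / 4 := hzb.trans_le (min_le_right _ _)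
  have : dist a r ≤ dist a b := max_le_max (dist_left_le r1) (dist_left_le r2)
  rw [mem_ball]
  linarith [dist_triangle z a r, dist_comm z r, dist_triangle_left a b z]

end MedianSets

section Directions

variable {T : Type*} [MetricSpace T] {x y z m a b : T} {δ : Set T}

namespace FourPointTree

variable (hT : FourPointTree T)
include hT

theorem connectedComponentIn_compl_singleton (hy : y ≠ x) :
    connectedComponentIn {x}ᶜ y = {z | x ∉ seg y z} := by
  apply Subset.antisymm
  · have hc : IsClosed {z | x ∈ seg y z} := isClosed_eq (by fun_prop) (by fun_prop)
    have ho : IsOpen ({z | x ∈ seg y z} \ {x}) := by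
      rw [Metric.isOpen_iff]
      rintro z ⟨hz, hzx⟩
      refine ⟨dist x z, dist_pos.2 (Ne.symm hzx), fun w hw => ⟨?_, ?_⟩⟩
      · rw [mem_ofPred_eq, mem_seg_iff] at *
        rw [mem_ball] at hw
        have := hT.four_point x w y z
        rw [dist_comm x y, dist_comm w y] at this
        rcases le_max_iff.1 this with h | h <;>
          linarith [dist_triangle y x w, dist_nonneg (x := x) (y := w)]
      · rintro rfl
        exact lt_irrefl _ (mem_ball.1 hw)
    refine isPreconnected_connectedComponentIn.subset_left_of_subset_union hc.isOpen_compl ho ?_ ?_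
      ⟨y, mem_connectedComponentIn hy, fun h => hy (eq_of_mem_seg_self h).symm⟩
    · exact Set.disjoint_left.2 fun z h h' => h h'.1
    · intro z hz
      have := connectedComponentIn_subset _ _ hz
      by_cases h : x ∈ seg y z
      exacts [Or.inr ⟨h, this⟩, Or.inl h]
  · intro z hz
    refine (hT.isPreconnected_seg y z).subset_connectedComponentIn (left_mem_seg y z) ?_
      (right_mem_seg y z)
    rintro w hw rfl
    exact hz hw

theorem isDirectionAt_iff : IsDirectionAt δ x ↔ ∃ y, y ≠ x ∧ δ = {z | x ∉ seg y z} := by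
  refine exists_congr fun y => and_congr_right fun hy => ?_
  rw [hT.connectedComponentIn_compl_singleton hy]

theorem isOpen_of_isDirection (h : IsDirection δ) : IsOpen δ := by
  obtain ⟨x, hx⟩ := h
  obtain ⟨y, hy, rfl⟩ := hT.isDirectionAt_iff.1 hx
  have hc : IsClosed {z | x ∈ seg y z} := isClosed_eq (by fun_prop) (by fun_prop)
  exact hc.isOpen_compl

theorem mem_or_mem_of_isDirection (h : IsDirection δ) (hm : m ∈ seg a b) (hmδ : m ∈ δ) :
    a ∈ δ ∨ b ∈ δ := by
  obtain ⟨x, hx⟩ := h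
  obtain ⟨y, hy, rfl⟩ := hT.isDirectionAt_iff.1 hx
  by_contra! hn
  simp only [mem_ofPred_eq, not_not] at hn
  exact hmδ (hT.mem_seg_of_mem_seg hm hn.1 hn.2)

theorem notMem_of_isDirectionAt (h : IsDirectionAt δ x) : x ∉ δ := by
  obtain ⟨y, hy, rfl⟩ := hT.isDirectionAt_iff.1 h
  exact fun hn => hn (right_mem_seg _ _)

theorem mem_of_isDirectionAt (h : IsDirectionAt δ x) (ha : a ∈ δ) (hm : m ∈ seg x a)
    (hmx : m ≠ x) : m ∈ δ := by
  obtain ⟨y, hy, rfl⟩ := hT.isDirectionAt_iff.1 h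
  exact fun hn => ha (hT.mem_seg_concat hn hm hmx.symm)

theorem isDirectionAt_setOf (h : x ≠ y) : IsDirectionAt {z | x ∉ seg y z} x :=
  hT.isDirectionAt_iff.2 ⟨y, h.symm, rfl⟩

theorem mem_of_openSeg_subset {S : Set T} (hS : IsClosed S) (h : x ≠ y) (hs : openSeg x y ⊆ S) :
    x ∈ S := by
  have hpos := dist_pos.2 h
  rw [← hS.closure_eq, Metric.mem_closure_iff]
  intro ε hε
  set s := min (ε / 2) (dist x y / 2)
  have hs0 : 0 < s := lt_min (half_pos hε) (half_pos hpos)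
  have hsε : s < ε := (min_le_left _ _).trans_lt (half_lt_self hε)
  have hsy : s < dist x y := (min_le_right _ _).trans_lt (half_lt_self hpos)
  obtain ⟨d1, d2⟩ := hT.dist_toward hs0.le hsy.le
  refine ⟨toward x y s, hs ⟨hT.toward_mem_seg hs0.le hsy.le, ?_⟩, d1.trans_lt hsε⟩
  rintro (e | e)
  · rw [e, dist_self] at d1; linarith
  · rw [mem_singleton_iff.1 e, dist_self] at d2; linarith

theorem openSeg_eq_of_subset (h : x ≠ y) (hs : openSeg x y ⊆ openSeg a b)
    (hx : x ∉ openSeg a b) (hy : y ∉ openSeg a b) : openSeg x y = openSeg a b := by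
  have hs' := hs.trans (sdiff_subset : openSeg a b ⊆ seg a b)
  have hx' := hT.mem_of_openSeg_subset (isClosed_seg a b) h hs'
  have hy' := hT.mem_of_openSeg_subset (isClosed_seg a b) h.symm (openSeg_comm x y ▸ hs')
  rcases eq_or_eq_of_notMem_openSeg hx hx' with rfl | rfl <;>
    rcases eq_or_eq_of_notMem_openSeg hy hy' with rfl | rfl
  exacts [absurd rfl h, rfl, openSeg_comm _ _, absurd rfl h]

end FourPointTree

theorem facingDirections_setOf (h : x ≠ y) :
    FacingDirections {z | x ∉ seg y z} {z | y ∉ seg x z} := by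
  refine eq_univ_of_forall fun z => ?_
  by_contra hn
  simp only [mem_union, mem_ofPred_eq, not_or, not_not, mem_seg_iff] at hn
  linarith [dist_pos.2 h, dist_comm x y, hn.1, hn.2]

theorem FacingDirections.symm {δ δ' : Set T} (h : FacingDirections δ δ') :
    FacingDirections δ' δ := by
  rw [FacingDirections, union_comm]
  exact h

theorem FacingDirections.mem_and_mem (hT : FourPointTree T) {δ δ' : Set T}
    (h : FacingDirections δ δ') (hx : IsDirectionAt δ x) (hy : IsDirectionAt δ' y)
    (hm : m ∈ openSeg x y) : m ∈ δ ∧ m ∈ δ' := by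
  have hxδ : x ∈ δ' := ((h.symm ▸ mem_univ x : x ∈ δ' ∪ δ)).resolve_right
    (hT.notMem_of_isDirectionAt hx)
  have hyδ : y ∈ δ := ((h ▸ mem_univ y : y ∈ δ ∪ δ')).resolve_right
    (hT.notMem_of_isDirectionAt hy)
  exact ⟨hT.mem_of_isDirectionAt hx hyδ hm.1 fun e => hm.2 (Or.inl e),
    hT.mem_of_isDirectionAt hy hxδ (mem_seg_comm hm.1) fun e => hm.2 (Or.inr e)⟩

end Directions

section ActionsOnTrees

variable {G T : Type*} [Group G] [MetricSpace T] [MulAction G T] {x y z : T}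

theorem IsometricAction.smul_mem_seg_iff (h : IsometricAction G T) (g : G) :
    g • z ∈ seg (g • x) (g • y) ↔ z ∈ seg x y := by
  rw [mem_seg_iff, mem_seg_iff, h, h, h]

theorem IsometricAction.smul_mem_openSeg_iff (h : IsometricAction G T) (g : G) :
    g • z ∈ openSeg (g • x) (g • y) ↔ z ∈ openSeg x y := by
  simp only [openSeg, Set.mem_sdiff, h.smul_mem_seg_iff, mem_insert_iff, mem_singleton_iff,
    smul_left_cancel_iff]

theorem IsometricAction.isDirection_preimage (h : IsometricAction G T) (hT : FourPointTree T)
    {δ : Set T} (hδ : IsDirection δ) (g : G) : IsDirection ((g • ·) ⁻¹' δ) := by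
  obtain ⟨x, hx⟩ := hδ
  obtain ⟨y, hy, rfl⟩ := hT.isDirectionAt_iff.1 hx
  refine ⟨g⁻¹ • x, hT.isDirectionAt_iff.2 ⟨g⁻¹ • y, by simpa using hy, ?_⟩⟩
  ext z
  simp only [mem_preimage, mem_ofPred_eq]
  rw [← h.smul_mem_seg_iff g (z := g⁻¹ • x), smul_inv_smul, smul_inv_smul]

end ActionsOnTrees

section CoreProperties

variable {G T₁ T₂ : Type*} [Group G] [MetricSpace T₁] [MetricSpace T₂]
  [MulAction G T₁] [MulAction G T₂]

theorem medianSet_core (h₁ : FourPointTree T₁) (h₂ : FourPointTree T₂) :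
    MedianSet (Core G T₁ T₂) where
  isClosed := by
    rw [← isOpen_compl_iff, isOpen_iff_forall_mem_open]
    intro z hz
    simp only [Core, mem_compl_iff, mem_ofPred_eq, not_forall] at hz
    obtain ⟨Q, hQ, hzQ, hn⟩ := hz
    refine ⟨Q, fun w hw hwC => hn (hwC Q hQ hw), ?_, hzQ⟩
    obtain ⟨δ₁, δ₂, hδ₁, hδ₂, rfl⟩ := hQ
    exact (h₁.isOpen_of_isDirection hδ₁).prod (h₂.isOpen_of_isDirection hδ₂)
  median_mem := by
    rintro p q r m n hp hq hr m1 m2 m3 n1 n2 n3 _ ⟨δ₁, δ₂, hδ₁, hδ₂, rfl⟩ hmn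
    have hQ : IsQuadrant (δ₁ ×ˢ δ₂) := ⟨δ₁, δ₂, hδ₁, hδ₂, rfl⟩
    have a1 := h₁.mem_or_mem_of_isDirection hδ₁ m1 hmn.1
    have a2 := h₁.mem_or_mem_of_isDirection hδ₁ m2 hmn.1
    have a3 := h₁.mem_or_mem_of_isDirection hδ₁ m3 hmn.1
    have b1 := h₂.mem_or_mem_of_isDirection hδ₂ n1 hmn.2
    have b2 := h₂.mem_or_mem_of_isDirection hδ₂ n2 hmn.2
    have b3 := h₂.mem_or_mem_of_isDirection hδ₂ n3 hmn.2
    have : p ∈ δ₁ ×ˢ δ₂ ∨ q ∈ δ₁ ×ˢ δ₂ ∨ r ∈ δ₁ ×ˢ δ₂ := by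
      simp only [mem_prod]
      tauto
    rcases this with h | h | h
    exacts [hp _ hQ h, hq _ hQ h, hr _ hQ h]
  convexFibers := by
    constructor
    · rintro x y hy y' hy' z hz _ ⟨δ₁, δ₂, hδ₁, hδ₂, rfl⟩ hmem
      have hQ : IsQuadrant (δ₁ ×ˢ δ₂) := ⟨δ₁, δ₂, hδ₁, hδ₂, rfl⟩
      rcases h₂.mem_or_mem_of_isDirection hδ₂ hz hmem.2 with h | h
      exacts [hy _ hQ ⟨hmem.1, h⟩, hy' _ hQ ⟨hmem.1, h⟩]
    · rintro x y hy y' hy' z hz _ ⟨δ₁, δ₂, hδ₁, hδ₂, rfl⟩ hmem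
      have hQ : IsQuadrant (δ₁ ×ˢ δ₂) := ⟨δ₁, δ₂, hδ₁, hδ₂, rfl⟩
      rcases h₁.mem_or_mem_of_isDirection hδ₁ hz hmem.1 with h | h
      exacts [hy _ hQ ⟨h, hmem.2⟩, hy' _ hQ ⟨h, hmem.2⟩]

theorem IsometricAction.tendsto_dist_mul_smul {T : Type*} [MetricSpace T] [MulAction G T]
    (h : IsometricAction G T) (g : G) {γ : ℕ → G} {x : T}
    (hγ : Tendsto (fun k => dist (γ k • x) x) atTop atTop) :
    Tendsto (fun k => dist ((g * γ k) • x) x) atTop atTop := by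
  refine tendsto_atTop_mono (fun k => ?_) (tendsto_atTop_add_const_right _ (-dist (g • x) x) hγ)
  rw [mul_smul, ← h g (γ k • x) x]
  linarith [dist_triangle_right (g • γ k • x) (g • x) x, dist_triangle (g • γ k • x) x (g • x),
    dist_comm x (g • x)]

theorem smul_mem_core (h₁ : FourPointTree T₁) (h₂ : FourPointTree T₂)
    (hi₁ : IsometricAction G T₁) (hi₂ : IsometricAction G T₂) (g : G) {z : T₁ × T₂}
    (hz : z ∈ Core G T₁ T₂) : g • z ∈ Core G T₁ T₂ := by
  rintro _ ⟨δ₁, δ₂, hδ₁, hδ₂, rfl⟩ hmem p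
  obtain ⟨γ, hγ, t1, t2⟩ := hz (((g • ·) ⁻¹' δ₁) ×ˢ ((g • ·) ⁻¹' δ₂))
    ⟨_, _, hi₁.isDirection_preimage h₁ hδ₁ g, hi₂.isDirection_preimage h₂ hδ₂ g, rfl⟩ hmem p
  refine ⟨fun k => g * γ k, fun k => ?_, hi₁.tendsto_dist_mul_smul g t1,
    hi₂.tendsto_dist_mul_smul g t2⟩
  simp only [mul_smul]
  exact hγ k

theorem Heavy.exists_mem_core (h₁ : FourPointTree T₁) (h₂ : FourPointTree T₂)
    (hi₁ : IsometricAction G T₁) (hi₂ : IsometricAction G T₂) (hne : (Core G T₁ T₂).Nonempty)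
    {Q : Set (T₁ × T₂)} (hQ : Heavy G Q) : ∃ c ∈ Core G T₁ T₂, c ∈ Q := by
  obtain ⟨c, hc⟩ := hne
  obtain ⟨γ, hγ, -⟩ := hQ c
  exact ⟨γ 0 • c, smul_mem_core h₁ h₂ hi₁ hi₂ _ hc, hγ 0⟩

theorem IsTwiceLightRect.notMem_openSeg (h₁ : FourPointTree T₁) (h₂ : FourPointTree T₂)
    {x x' c : T₁ × T₂} (h : IsTwiceLightRect G x x') (hc : c ∈ Core G T₁ T₂) :
    c.1 ∉ openSeg x.1 x'.1 ∧ c.2 ∉ openSeg x.2 x'.2 := by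
  obtain ⟨δ₁, δ₂, δ₁', δ₂', d1, d2, d1', d2', -, -, f1, f2, l, l'⟩ := h
  have hl : c ∉ δ₁ ×ˢ δ₂ := fun hm => l (hc _ ⟨_, _, ⟨_, d1⟩, ⟨_, d2⟩, rfl⟩ hm)
  have hl' : c ∉ δ₁' ×ˢ δ₂' := fun hm => l' (hc _ ⟨_, _, ⟨_, d1'⟩, ⟨_, d2'⟩, rfl⟩ hm)
  constructor
  · intro hm
    obtain ⟨m, m'⟩ := f1.mem_and_mem h₁ d1 d1' hm
    rcases (f2 ▸ mem_univ c.2 : c.2 ∈ δ₂ ∪ δ₂') with h | h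
    exacts [hl ⟨m, h⟩, hl' ⟨m', h⟩]
  · intro hm
    obtain ⟨m, m'⟩ := f2.mem_and_mem h₂ d2 d2' hm
    rcases (f1 ▸ mem_univ c.1 : c.1 ∈ δ₁ ∪ δ₁') with h | h
    exacts [hl ⟨h, m⟩, hl' ⟨h, m'⟩]

theorem openSeg_eq_of_pair_eq {T : Type*} [MetricSpace T] {p q x y : T}
    (h : ({p, q} : Set T) = {x, y}) : openSeg p q = openSeg x y := by
  rcases Set.pair_eq_pair_iff.1 h with ⟨rfl, rfl⟩ | ⟨rfl, rfl⟩
  exacts [rfl, openSeg_comm _ _]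

theorem IsJump.isTwiceLightRect (h₁ : FourPointTree T₁) (h₂ : FourPointTree T₂)
    (hi₁ : IsometricAction G T₁) (hi₂ : IsometricAction G T₂) (hne : (Core G T₁ T₂).Nonempty)
    {p q : T₁ × T₂} (h : IsJump (Core G T₁ T₂) p q) :
    IsTwiceLightRect G (p.1, q.2) (q.1, p.2) := by
  have hC := medianSet_core (G := G) h₁ h₂
  refine ⟨{z | p.1 ∉ seg q.1 z}, {z | q.2 ∉ seg p.2 z}, {z | q.1 ∉ seg p.1 z},
    {z | p.2 ∉ seg q.2 z}, h₁.isDirectionAt_setOf h.fst_ne, h₂.isDirectionAt_setOf h.snd_ne.symm,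
    h₁.isDirectionAt_setOf h.fst_ne.symm, h₂.isDirectionAt_setOf h.snd_ne, h.fst_ne,
    h.snd_ne.symm, facingDirections_setOf h.fst_ne, facingDirections_setOf h.snd_ne.symm,
    fun hh => ?_, fun hh => ?_⟩
  all_goals
    obtain ⟨c, hc, c1, c2⟩ := hh.exists_mem_core h₁ h₂ hi₁ hi₂ hne
    obtain ⟨r, rfl | rfl, r1, r2, r3, r4⟩ := h.exists_gate hC h₁ h₂ hc
  exacts [c1 r2, c2 r3, c2 r4, c1 r1]

theorem augCore_eq_jumpHull (h₁ : FourPointTree T₁) (h₂ : FourPointTree T₂)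
    (hi₁ : IsometricAction G T₁) (hi₂ : IsometricAction G T₂)
    (hne : (Core G T₁ T₂).Nonempty) : AugCore G T₁ T₂ = jumpHull (Core G T₁ T₂) := by
  ext z
  refine or_congr Iff.rfl ⟨?_, ?_⟩
  · rintro ⟨x, x', p, q, ⟨hx, -⟩, hp, hq, e1, e2, n1, n2, hz⟩
    refine ⟨p, q, ⟨hp, hq, n1, n2, fun c hc => ?_, fun c hc => ?_⟩, hz⟩
    · rw [openSeg_eq_of_pair_eq e1]
      exact (hx.notMem_openSeg h₁ h₂ hc).1
    · rw [openSeg_eq_of_pair_eq e2]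
      exact (hx.notMem_openSeg h₁ h₂ hc).2
  · rintro ⟨p, q, h, hz⟩
    refine ⟨(p.1, q.2), (q.1, p.2), p, q,
      ⟨h.isTwiceLightRect h₁ h₂ hi₁ hi₂ hne, fun y y' hy hsub => ?_⟩, h.left_mem, h.right_mem,
      rfl, pair_comm _ _, h.fst_ne, h.snd_ne, hz⟩
    have hp := hy.notMem_openSeg h₁ h₂ h.left_mem
    have hq := hy.notMem_openSeg h₁ h₂ h.right_mem
    obtain ⟨s1, s2⟩ := (prod_subset_prod_iff.1 hsub).resolve_right fun hn =>
      hn.elim (h₁.openSeg_nonempty h.fst_ne).ne_empty (h₂.openSeg_nonempty h.snd_ne.symm).ne_empty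
    exact congrArg₂ (· ×ˢ ·) (h₁.openSeg_eq_of_subset h.fst_ne s1 hp.1 hq.1)
      (h₂.openSeg_eq_of_subset h.snd_ne.symm s2 hq.2 hp.2)

theorem smul_mem_jumpHull (hi₁ : IsometricAction G T₁) (hi₂ : IsometricAction G T₂)
    {C : Set (T₁ × T₂)} (hC : ∀ g : G, ∀ z ∈ C, g • z ∈ C) (g : G) {z : T₁ × T₂}
    (hz : z ∈ jumpHull C) : g • z ∈ jumpHull C := by
  rcases hz with hz | ⟨p, q, h, z1, z2, z3⟩
  · exact Or.inl (hC g z hz)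
  refine Or.inr ⟨g • p, g • q, ⟨hC g p h.left_mem, hC g q h.right_mem, ?_, ?_, ?_, ?_⟩,
    (hi₁.smul_mem_seg_iff g).2 z1, (hi₂.smul_mem_seg_iff g).2 z2, ?_⟩
  · exact fun e => h.fst_ne (smul_left_cancel g e)
  · exact fun e => h.snd_ne (smul_left_cancel g e)
  · intro c hc hm
    refine h.fst_notMem _ (hC g⁻¹ c hc) ((hi₁.smul_mem_openSeg_iff g).1 ?_)
    simpa using hm
  · intro c hc hm
    refine h.snd_notMem _ (hC g⁻¹ c hc) ((hi₂.smul_mem_openSeg_iff g).1 ?_)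
    simpa using hm
  · simpa only [Prod.smul_fst, Prod.smul_snd, hi₁ g, hi₂ g] using z3

end CoreProperties

section Contractibility

theorem FourPointTree.contractibleSpace {T : Type*} [MetricSpace T] (hT : FourPointTree T)
    (o : T) : ContractibleSpace T := by
  have hD : CrossConvex ({(o, o)} : Set (T × T)) := by
    constructor <;>
    · rintro p rfl q rfl x hx
      exact ⟨o, left_mem_seg _ _, by simpa using eq_of_mem_seg_self hx⟩
  set σ : unitInterval × T → ℝ := fun p => p.1 * dist p.2 o with hσ
  have hσ0 : ∀ p, 0 ≤ σ p := fun p => mul_nonneg p.1.2.1 dist_nonneg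
  have hσ1 : ∀ p, σ p ≤ dist p.2 o := fun p => mul_le_of_le_one_left dist_nonneg p.1.2.2
  have hc : Continuous fun p : unitInterval × T => toward p.2 o (σ p) := by
    rw [continuous_iff_continuousAt]
    intro p
    rw [ContinuousAt, tendsto_iff_dist_tendsto_zero]
    refine squeeze_zero (fun _ => dist_nonneg) (fun q => hD.dist_toward_le hT (y := o) (y' := o)
      rfl rfl (hσ0 q) (hσ0 p) ?_ ?_) ?_
    · rintro _ rfl
      exact le_max_of_le_left (hσ1 q)
    · rintro _ rfl
      exact le_max_of_le_left (hσ1 p)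
    · have : Continuous fun q : unitInterval × T =>
          3 * max (dist q.2 p.2) (dist o o) + |σ q - σ p| := by fun_prop
      simpa using this.tendsto p
  refine (contractible_iff_id_nullhomotopic T).2 ⟨o, ⟨⟨⟨_, hc⟩, fun x => ?_, fun x => ?_⟩⟩⟩
  · simp [hσ, toward_zero]
  · obtain ⟨-, h⟩ := hT.dist_toward (x := x) (a := o) dist_nonneg le_rfl
    simpa [hσ] using h

theorem FourPointTree.subtype {T : Type*} [MetricSpace T] (hT : FourPointTree T) {S : Set T}
    (hS : TreeConvex S) : FourPointTree S where
  four_point x y z w := hT.four_point x y z w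
  exists_point x y s h0 h1 :=
    ⟨⟨toward x.1 y.1 s, hS _ x.2 _ y.2 (hT.toward_mem_seg h0 h1)⟩, hT.dist_toward h0 h1⟩

variable {T₁ T₂ : Type*} [MetricSpace T₁] [MetricSpace T₂] {D : Set (T₁ × T₂)}

theorem CrossConvex.treeConvex_image_fst (hD : CrossConvex D) : TreeConvex (Prod.fst '' D) := by
  rintro _ ⟨p, hp, rfl⟩ _ ⟨q, hq, rfl⟩ x hx
  obtain ⟨y, -, h⟩ := hD.left p hp q hq x hx
  exact ⟨_, h, rfl⟩

theorem CrossConvex.treeConvex_image_snd (hD : CrossConvex D) : TreeConvex (Prod.snd '' D) := by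
  rintro _ ⟨p, hp, rfl⟩ _ ⟨q, hq, rfl⟩ x hx
  obtain ⟨y, -, h⟩ := hD.right p hp q hq x hx
  exact ⟨_, h, rfl⟩

theorem CrossConvex.inter_prod_seg (hD : CrossConvex D) (h₁ : FourPointTree T₁)
    (h₂ : FourPointTree T₂) {a₁ b₁ : T₁} {a₂ b₂ : T₂} :
    CrossConvex ((seg a₁ b₁ ×ˢ seg a₂ b₂) ∩ D) where
  left p hp q hq x hx := by
    obtain ⟨y, hy, h⟩ := hD.left p hp.2 q hq.2 x hx
    exact ⟨y, hy, ⟨h₁.seg_subset hp.1.1 hq.1.1 hx, h₂.seg_subset hp.1.2 hq.1.2 hy⟩, h⟩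
  right p hp q hq y hy := by
    obtain ⟨x, hx, h⟩ := hD.right p hp.2 q hq.2 y hy
    exact ⟨x, hx, ⟨h₁.seg_subset hp.1.1 hq.1.1 hx, h₂.seg_subset hp.1.2 hq.1.2 hy⟩, h⟩

theorem CrossConvex.contractibleSpace (hD : CrossConvex D) (hDc : IsClosed D)
    (h₁ : FourPointTree T₁) (h₂ : FourPointTree T₂) (hne : D.Nonempty) :
    ContractibleSpace D := by
  have h₁' := h₁.subtype hD.treeConvex_image_fst
  have h₂' := h₂.subtype hD.treeConvex_image_snd
  set ι : (Prod.fst '' D) × (Prod.snd '' D) → T₁ × T₂ := Prod.map Subtype.val Subtype.val with hι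
  have hιc : Continuous ι := by fun_prop
  have hE : CrossConvex (ι ⁻¹' D) := by
    constructor
    · intro p hp q hq x hx
      obtain ⟨y, hy, h⟩ := hD.left _ hp _ hq x.1 hx
      exact ⟨⟨y, _, h, rfl⟩, hy, h⟩
    · intro p hp q hq y hy
      obtain ⟨x, hx, h⟩ := hD.right _ hp _ hq y.1 hy
      exact ⟨⟨x, _, h, rfl⟩, hx, h⟩
  obtain ⟨H, hc, -, hmem, hfix, -⟩ := hE.exists_retraction (hDc.preimage hιc) h₁' h₂'
    (by
      rintro ⟨_, p, hp, rfl⟩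
      exact ⟨⟨p.2, p, hp, rfl⟩, hp⟩)
    (by
      rintro ⟨_, p, hp, rfl⟩
      exact ⟨⟨p.1, p, hp, rfl⟩, hp⟩)
  obtain ⟨c, hcD⟩ := hne
  have := h₁'.contractibleSpace ⟨c.1, c, hcD, rfl⟩
  have := h₂'.contractibleSpace ⟨c.2, c, hcD, rfl⟩
  let i : C(D, (Prod.fst '' D) × (Prod.snd '' D)) :=
    ⟨fun z => (⟨z.1.1, z.1, z.2, rfl⟩, ⟨z.1.2, z.1, z.2, rfl⟩), by fun_prop⟩
  let r : C((Prod.fst '' D) × (Prod.snd '' D), D) :=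
    ⟨fun z => ⟨ι (H 1 z), hmem z⟩,
      (hιc.comp (hc.comp (Continuous.prodMk_right 1))).subtype_mk _⟩
  have hri : r.comp i = ContinuousMap.id D := by
    ext1 z
    exact Subtype.ext (congrArg ι (hfix 1 (i z) z.2))
  rw [contractible_iff_id_nullhomotopic, ← hri]
  exact ((id_nullhomotopic _).comp_right r).comp_left i

end Contractibility

/-- Proposition 5.7: for minimal actions with non-empty core, there is
an equivariant deformation retraction of `T₁ × T₂` onto the augmented core `Ĉ`; in
particular `Ĉ` is contractible, and its trace on every rectangle is empty or
contractible. -/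
theorem augmented_core_deformation_retract
    {G T₁ T₂ : Type*} [Group G] [MetricSpace T₁] [MetricSpace T₂]
    [MulAction G T₁] [MulAction G T₂]
    (hT₁ : IsRTree T₁) (hT₂ : IsRTree T₂)
    (hiso₁ : IsometricAction G T₁) (hiso₂ : IsometricAction G T₂)
    (hmin₁ : MinimalAction G T₁) (hmin₂ : MinimalAction G T₂)
    (hne : (Core G T₁ T₂).Nonempty) :
    EquivDeformRetract G (AugCore G T₁ T₂) ∧
    ContractibleSpace (AugCore G T₁ T₂) ∧
    (∀ (a₁ b₁ : T₁) (a₂ b₂ : T₂),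
      (seg a₁ b₁ ×ˢ seg a₂ b₂) ∩ AugCore G T₁ T₂ = ∅ ∨
      ContractibleSpace ((seg a₁ b₁ ×ˢ seg a₂ b₂) ∩ AugCore G T₁ T₂ : Set (T₁ × T₂))) := by
  have h₁ := hT₁.fourPointTree
  have h₂ := hT₂.fourPointTree
  have hC := medianSet_core (G := G) h₁ h₂
  have hinv : ∀ (g : G), ∀ z ∈ jumpHull (Core G T₁ T₂), g • z ∈ jumpHull (Core G T₁ T₂) :=
    fun g _ => smul_mem_jumpHull hiso₁ hiso₂
      (fun g _ => smul_mem_core h₁ h₂ hiso₁ hiso₂ g) g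
  obtain ⟨c, hc⟩ := hne
  rw [augCore_eq_jumpHull h₁ h₂ hiso₁ hiso₂ ⟨c, hc⟩]
  have hD := hC.crossConvex_jumpHull h₁ h₂
  have hDc := hC.isClosed_jumpHull h₁ h₂
  set D := jumpHull (Core G T₁ T₂)
  have hcD : c ∈ D := Or.inl hc
  refine ⟨?_, hD.contractibleSpace hDc h₁ h₂ ⟨c, hcD⟩, fun a₁ b₁ a₂ b₂ => ?_⟩
  · have hu₁ : Prod.fst '' D = univ := hmin₁ _ ⟨_, mem_image_of_mem _ hcD⟩
      hD.treeConvex_image_fst fun g _ ⟨z, hz, e⟩ => ⟨g • z, hinv g z hz, congrArg (g • ·) e⟩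
    have hu₂ : Prod.snd '' D = univ := hmin₂ _ ⟨_, mem_image_of_mem _ hcD⟩
      hD.treeConvex_image_snd fun g _ ⟨z, hz, e⟩ => ⟨g • z, hinv g z hz, congrArg (g • ·) e⟩
    obtain ⟨H, H1, H2, H3, H4, H5⟩ := hD.exists_retraction hDc h₁ h₂
      (fun x => by simpa using hu₁.ge (mem_univ x)) (fun y => by simpa using hu₂.ge (mem_univ y))
    refine ⟨H, H1, H2, H3, H4, fun t g z => H5 t (g • ·) (g • ·)
      (Isometry.of_dist_eq (hiso₁ g)) (Isometry.of_dist_eq (hiso₂ g)) ?_ z⟩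
    refine (image_subset_iff.2 (hinv g)).antisymm fun z hz => ⟨g⁻¹ • z, hinv g⁻¹ z hz, ?_⟩
    exact smul_inv_smul g z
  · rcases eq_empty_or_nonempty ((seg a₁ b₁ ×ˢ seg a₂ b₂) ∩ D) with h | h
    · exact Or.inl h
    · exact Or.inr ((hD.inter_prod_seg h₁ h₂).contractibleSpace
        (((isClosed_seg a₁ b₁).prod (isClosed_seg a₂ b₂)).inter hDc) h₁ h₂ h)

end Guirardel
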